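/- arXiv:2203.16904 — 5 statements merged into one kernel-verified Lean document; each statement's English description precedes it below -/
import Mathlib

section
/- In the critical case, with v(t;x) := (Φ(t;x) − P_{10}(t) − P_{11}(t)·x)/x, the iterated integral J₂(t) := b·∫_0^1 (1/x)·(∫_0^x v(t;s)/s ds) dx converges for every t > 0 and satisfies J₂(t) = O(ln t / t²) as t → ∞. -/
open scoped Topology

lemma aux_h_nonneg (y : ℝ) (h0 : 0 ≤ y) (h1 : y ≤ 1) (k : ℕ) :
    (1 - y) ^ 2 ≤ y ^ (k + 2) - 1 + ((k + 2 : ℕ) : ℝ) * (1 - y) := by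
  induction k with
  | zero => norm_num; nlinarith
  | succ k ih =>
    have h2 : y ^ (k + 2) ≤ 1 := pow_le_one₀ h0 h1
    have h3 : y ^ (k + 1 + 2) = y ^ (k + 2) * y := by ring
    rw [h3]
    push_cast at ih ⊢
    nlinarith [mul_nonneg (sub_nonneg.2 h1) (sub_nonneg.2 h2)]

lemma aux_h_upper (y : ℝ) (h0 : 0 ≤ y) (h1 : y ≤ 1) (k : ℕ) :
    y ^ k - 1 + (k : ℝ) * (1 - y) ≤ (k : ℝ) * ((k : ℝ) - 1) / 2 * (1 - y) ^ 2 := by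
  induction k with
  | zero => norm_num
  | succ k ih =>
    have h2 : 1 - y ^ k ≤ k * (1 - y) := by
      have := one_add_mul_le_pow (a := y - 1) (by linarith) k
      simp only [add_sub_cancel] at this
      nlinarith
    have h3 : y ^ (k + 1) = y ^ k * y := by ring
    rw [h3]
    push_cast at ih ⊢
    nlinarith [mul_le_mul_of_nonneg_left h2 (sub_nonneg.2 h1)]

lemma aux_cont (p : ℕ → ℝ) (hp : ∀ j, 0 ≤ p j) (hs : Summable p) :
    ContinuousOn (fun s : ℝ => ∑' j, p j * s ^ j) (Set.Icc 0 1) := by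
  refine continuousOn_tsum (u := p) (fun i => by fun_prop) hs ?_
  intro n x hx
  rw [Real.norm_of_nonneg (mul_nonneg (hp n) (pow_nonneg hx.1 n))]
  exact mul_le_of_le_one_right (hp n) (pow_le_one₀ hx.1 hx.2)

lemma aux_summable (p : ℕ → ℝ) (hp : ∀ j, 0 ≤ p j) (hs : Summable p) (x : ℝ)
    (hx : x ∈ Set.Icc (0:ℝ) 1) : Summable (fun j => p j * x ^ j) :=
  hs.of_nonneg_of_le (fun n => mul_nonneg (hp n) (pow_nonneg hx.1 n))
    (fun n => mul_le_of_le_one_right (hp n) (pow_le_one₀ hx.1 hx.2))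

lemma aux_integral (p : ℕ → ℝ) (hp : ∀ j, 0 ≤ p j) (hs : Summable p) (x : ℝ)
    (hx : x ∈ Set.Icc (0:ℝ) 1) :
    HasSum (fun j : ℕ => p j / ((j : ℝ) + 1) * x ^ (j + 1))
      (∫ s in (0:ℝ)..x, ∑' j, p j * s ^ j) := by
  have key : HasSum (fun j : ℕ => ∫ s in (0:ℝ)..x, p j * s ^ j)
      (∫ s in (0:ℝ)..x, ∑' j, p j * s ^ j) := by
    have hsub : ∀ t ∈ Set.uIoc (0:ℝ) x, t ∈ Set.Icc (0:ℝ) 1 := by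
      intro t ht
      rw [Set.uIoc_of_le hx.1] at ht
      exact ⟨ht.1.le, ht.2.trans hx.2⟩
    refine intervalIntegral.hasSum_integral_of_dominated_convergence (fun j _ => p j) ?_ ?_ ?_ ?_ ?_
    · intro n
      exact Continuous.aestronglyMeasurable (by fun_prop)
    · intro n
      refine Filter.Eventually.of_forall fun t ht => ?_
      have hx := hsub t ht
      rw [Real.norm_of_nonneg (mul_nonneg (hp n) (pow_nonneg hx.1 n))]
      exact mul_le_of_le_one_right (hp n) (pow_le_one₀ hx.1 hx.2)
    · exact Filter.Eventually.of_forall fun t ht => hs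
    · simp
    · exact Filter.Eventually.of_forall fun t ht => (aux_summable p hp hs t (hsub t ht)).hasSum
  convert key using 2 with j
  rw [intervalIntegral.integral_const_mul, integral_pow]
  simp
  ring

/-- from a pointwise bound of partial sums to a bound for the weighted sums -/
lemma aux_weight (p : ℕ → ℝ) (hp : ∀ j, 0 ≤ p j) (M : ℝ) (n : ℕ)
    (h : ∀ s ∈ Set.Icc (0:ℝ) 1, (∑ j ∈ Finset.range n, p j * s ^ j) * (1 - s) ≤ M) :
    ∑ j ∈ Finset.range n, p j / ((j : ℝ) + 1) / ((j : ℝ) + 1) ≤ 2 * M := by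
  have h1 : ∫ s in (0:ℝ)..1, (∑ j ∈ Finset.range n, p j * s ^ j) * (1 - s) ≤ M := by
    have := intervalIntegral.integral_mono_on (a := (0:ℝ)) (b := 1) (μ := MeasureTheory.volume)
      (f := fun s => (∑ j ∈ Finset.range n, p j * s ^ j) * (1 - s)) (g := fun _ => M)
      zero_le_one (Continuous.intervalIntegrable (by fun_prop) _ _) (by simp) h
    simpa using this
  have h2 : ∫ s in (0:ℝ)..1, (∑ j ∈ Finset.range n, p j * s ^ j) * (1 - s)
      = ∑ j ∈ Finset.range n, p j * (1 / ((j : ℝ) + 1) - 1 / ((j : ℝ) + 2)) := by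
    have : (fun s : ℝ => (∑ j ∈ Finset.range n, p j * s ^ j) * (1 - s))
        = fun s => ∑ j ∈ Finset.range n, p j * (s ^ j - s ^ (j + 1)) := by
      funext s
      rw [Finset.sum_mul]
      refine Finset.sum_congr rfl fun j _ => by ring
    rw [this, intervalIntegral.integral_finsetSum]
    · refine Finset.sum_congr rfl fun j _ => ?_
      rw [intervalIntegral.integral_const_mul, intervalIntegral.integral_sub, integral_pow,
        integral_pow]
      · simp
        left
        ring
      · exact Continuous.intervalIntegrable (by fun_prop) _ _
      · exact Continuous.intervalIntegrable (by fun_prop) _ _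
    · intro i _
      exact Continuous.intervalIntegrable (by fun_prop) _ _
  rw [h2] at h1
  calc _ ≤ ∑ j ∈ Finset.range n, 2 * (p j * (1 / ((j : ℝ) + 1) - 1 / ((j : ℝ) + 2))) := by
        refine Finset.sum_le_sum fun j _ => ?_
        have hj : (0:ℝ) ≤ j := Nat.cast_nonneg j
        have : (1 : ℝ) / (j + 1) / (j + 1) ≤ 2 * (1 / ((j : ℝ) + 1) - 1 / ((j : ℝ) + 2)) := by
          rw [div_sub_div _ _ (by positivity) (by positivity), div_div, ← mul_div_assoc,
            div_le_div_iff₀ (by positivity) (by positivity)]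
          nlinarith [mul_nonneg hj hj, mul_nonneg hj (mul_nonneg hj hj)]
        have := mul_le_mul_of_nonneg_left this (hp j)
        calc _ = p j * ((1 : ℝ) / (j + 1) / (j + 1)) := by ring
          _ ≤ _ := this
          _ = _ := by ring
    _ ≤ 2 * M := by rw [← Finset.mul_sum]; linarith

/-- decay of the non-extinction probability -/
lemma aux_decay (u : ℝ → ℝ) (F : ℝ → ℝ) (c : ℝ) (hc : 0 < c)
    (hu : ∀ t, 0 ≤ t → 0 ≤ u t) (hF : ∀ t, 0 ≤ t → c * u t ^ 2 ≤ F t)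
    (hd : ∀ t, 0 ≤ t → HasDerivAt u (-F t) t) :
    AntitoneOn u (Set.Ici 0) ∧ ∀ t, 0 < t → u t ≤ 1 / (c * t) := by
  have hanti : AntitoneOn u (Set.Ici 0) := by
    refine antitoneOn_of_hasDerivWithinAt_nonpos (convex_Ici 0) (f' := fun t => - F t)
      (fun x hx => (hd x hx).continuousAt.continuousWithinAt)
      (fun x hx => (hd x (interior_subset hx)).hasDerivWithinAt) ?_
    intro x hx
    have := hF x (interior_subset hx)
    have : 0 ≤ c * u x ^ 2 := by positivity
    linarith
  refine ⟨hanti, fun t ht => ?_⟩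
  rcases (hu t ht.le).eq_or_lt with h0 | hpos
  · rw [← h0]; positivity
  have hp : ∀ s ∈ Set.Icc 0 t, 0 < u s := fun s hs =>
    hpos.trans_le (hanti hs.1 ht.le hs.2)
  have hD : ∀ s ∈ Set.Icc 0 t, HasDerivAt (fun s => (u s)⁻¹ - c * s)
      (-(-F s) / u s ^ 2 - c * 1) s := fun s hs =>
    ((hd s hs.1).fun_inv (hp s hs).ne').sub ((hasDerivAt_id s).const_mul c)
  have hmono : MonotoneOn (fun s => (u s)⁻¹ - c * s) (Set.Icc 0 t) := by
    refine monotoneOn_of_hasDerivWithinAt_nonneg (convex_Icc 0 t)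
      (fun x hx => (hD x hx).continuousAt.continuousWithinAt)
      (fun x hx => (hD x (interior_subset hx)).hasDerivWithinAt) ?_
    intro x hx
    have h1 := hF x (interior_subset hx).1
    have h2 := hp x (interior_subset hx)
    rw [neg_neg, mul_one, sub_nonneg, le_div_iff₀ (by positivity)]
    exact h1
  have h := hmono (Set.left_mem_Icc.2 ht.le) (Set.right_mem_Icc.2 ht.le) ht.le
  simp only [mul_zero, sub_zero] at h
  have h3 : 0 < (u 0)⁻¹ := inv_pos.2 (hp 0 (Set.left_mem_Icc.2 ht.le))
  have h4 : c * t ≤ (u t)⁻¹ := by linarith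
  rw [le_div_iff₀ (by positivity)]
  have := mul_le_mul_of_nonneg_left h4 hpos.le
  rwa [mul_inv_cancel₀ hpos.ne'] at this

lemma aux_f_bounds (a : ℕ → ℝ) (f : ℝ → ℝ)
    (ha : ∀ k : ℕ, k ≠ 1 → 0 ≤ a k)
    (ha1 : HasSum (fun k : ℕ => if k = 1 then (0:ℝ) else a k) (-(a 1)))
    (hf : ∀ x ∈ Set.Icc (0:ℝ) 1, HasSum (fun k : ℕ => a k * x ^ k) (f x))
    (b : ℝ)
    (hcrit : HasSum (fun k : ℕ => (k : ℝ) * a k) 0)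
    (hb : HasSum (fun k : ℕ => (k : ℝ) * ((k : ℝ) - 1) * a k) b) :
    ∀ y ∈ Set.Icc (0:ℝ) 1, (-(a 1) - a 0) * (1 - y) ^ 2 ≤ f y ∧ f y ≤ b / 2 * (1 - y) ^ 2 := by
  intro y hy
  have hsum : HasSum a 0 := by
    have := ha1.add (hasSum_ite_eq 1 (a 1))
    rw [neg_add_cancel] at this
    convert this using 2 with k
    split_ifs with h <;> simp [h]
  have hmain : HasSum (fun k : ℕ => a k * (y ^ k - 1 + (k : ℝ) * (1 - y))) (f y) := by
    have := ((hf y hy).sub hsum).add (hcrit.mul_right (1 - y))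
    simp only [sub_zero, zero_mul, add_zero] at this
    exact this.congr_fun (fun k => by ring)
  constructor
  · have h2 := (ha1.sub (hasSum_ite_eq 0 (a 0))).mul_right ((1 - y) ^ 2)
    refine hasSum_le ?_ h2 hmain
    intro k
    match k with
    | 0 => simp
    | 1 => simp
    | k + 2 =>
      have := mul_le_mul_of_nonneg_left (aux_h_nonneg y hy.1 hy.2 k) (ha (k + 2) (by omega))
      simpa using this
  · refine hasSum_le ?_ hmain ((hb.div_const 2).mul_right ((1 - y) ^ 2))
    intro k
    by_cases hk : k = 1
    · subst hk; simp
    · have := mul_le_mul_of_nonneg_left (aux_h_upper y hy.1 hy.2 k) (ha k hk)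
      calc _ ≤ _ := this
        _ = _ := by ring

lemma aux_f_lip (a : ℕ → ℝ) (f : ℝ → ℝ)
    (hf : ∀ x ∈ Set.Icc (0:ℝ) 1, HasSum (fun k : ℕ => a k * x ^ k) (f x))
    (hcrit : Summable (fun k : ℕ => (k : ℝ) * a k)) :
    ∃ K : NNReal, LipschitzOnWith K f (Set.Icc 0 1) := by
  have hs := hcrit.abs
  refine ⟨⟨∑' k : ℕ, |(k : ℝ) * a k|, tsum_nonneg fun _ => abs_nonneg _⟩, ?_⟩
  refine LipschitzOnWith.of_dist_le_mul fun x hx y hy => ?_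
  rw [Real.dist_eq, Real.dist_eq]
  have h := (hf x hx).sub (hf y hy)
  rw [← h.tsum_eq]
  have hle : ∀ k : ℕ, ‖a k * x ^ k - a k * y ^ k‖ ≤ |(k : ℝ) * a k| * |x - y| := by
    intro k
    rw [← mul_sub, Real.norm_eq_abs, abs_mul, abs_mul, Nat.abs_cast]
    have h1 := abs_pow_sub_pow_le x y k
    have h2 : max |x| |y| ^ (k - 1) ≤ 1 := by
      refine pow_le_one₀ (by positivity) (max_le ?_ ?_)
      · rw [abs_of_nonneg hx.1]; exact hx.2
      · rw [abs_of_nonneg hy.1]; exact hy.2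
    have h3 : |x ^ k - y ^ k| ≤ |x - y| * k :=
      h1.trans (mul_le_of_le_one_right (by positivity) h2)
    calc _ ≤ |a k| * (|x - y| * k) := mul_le_mul_of_nonneg_left h3 (abs_nonneg _)
      _ = _ := by ring
  exact tsum_of_norm_bounded (hs.hasSum.mul_right _) hle

theorem stmt_13
    (a : ℕ → ℝ) (f : ℝ → ℝ) (P : ℝ → ℕ → ℝ) (Φ : ℝ → ℝ → ℝ)
    (ha : ∀ k : ℕ, k ≠ 1 → 0 ≤ a k)
    (ha0 : 0 < a 0)
    (ha1 : HasSum (fun k : ℕ => if k = 1 then (0:ℝ) else a k) (-(a 1)))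
    (ha01 : a 0 < -(a 1))
    (hf : ∀ x ∈ Set.Icc (0:ℝ) 1, HasSum (fun k : ℕ => a k * x ^ k) (f x))
    (hPnn : ∀ t : ℝ, 0 ≤ t → ∀ j : ℕ, 0 ≤ P t j)
    (hPsum : ∀ t : ℝ, 0 ≤ t → HasSum (fun j : ℕ => P t j) 1)
    (hΦ : ∀ t : ℝ, 0 ≤ t → ∀ x ∈ Set.Icc (0:ℝ) 1, HasSum (fun j : ℕ => P t j * x ^ j) (Φ t x))
    (hΦ0 : ∀ x ∈ Set.Icc (0:ℝ) 1, Φ 0 x = x)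
    (hKol : ∀ x ∈ Set.Icc (0:ℝ) 1, ∀ t : ℝ, 0 ≤ t → HasDerivAt (fun s => Φ s x) (f (Φ t x)) t)
    (b : ℝ)
    (hcrit : HasSum (fun k : ℕ => (k : ℝ) * a k) 0)
    (hb : HasSum (fun k : ℕ => (k : ℝ) * ((k : ℝ) - 1) * a k) b)
    :
    (∀ t : ℝ, 0 < t → ∀ x ∈ Set.Icc (0:ℝ) 1,
        IntervalIntegrable (fun s : ℝ => (Φ t s - P t 0 - P t 1 * s) / s / s)
          MeasureTheory.volume 0 x) ∧
    (∀ t : ℝ, 0 < t →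
        IntervalIntegrable
          (fun x : ℝ => (∫ s in (0:ℝ)..x, (Φ t s - P t 0 - P t 1 * s) / s / s) / x)
          MeasureTheory.volume 0 1) ∧
    (fun t : ℝ => b * ∫ x in (0:ℝ)..1,
        (∫ s in (0:ℝ)..x, (Φ t s - P t 0 - P t 1 * s) / s / s) / x)
      =O[Filter.atTop] fun t : ℝ => Real.log t / t ^ 2 := by
  set c : ℝ := -(a 1) - a 0 with hc
  have hcpos : 0 < c := by rw [hc]; linarith
  have hfb := aux_f_bounds a f ha ha1 hf b hcrit hb
  obtain ⟨L, hL⟩ := aux_f_lip a f hf hcrit.summable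
  have h0m : (0:ℝ) ∈ Set.Icc (0:ℝ) 1 := ⟨le_rfl, zero_le_one⟩
  have hb0 : 0 ≤ b := by
    have := hfb 0 h0m
    norm_num at this
    linarith
  have hmem : ∀ t : ℝ, 0 ≤ t → ∀ x ∈ Set.Icc (0:ℝ) 1, Φ t x ∈ Set.Icc (0:ℝ) 1 := by
    intro t ht x hx
    refine ⟨(hΦ t ht x hx).nonneg fun j => mul_nonneg (hPnn t ht j) (pow_nonneg hx.1 j), ?_⟩
    exact hasSum_le (fun j => mul_le_of_le_one_right (hPnn t ht j) (pow_le_one₀ hx.1 hx.2))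
      (hΦ t ht x hx) (hPsum t ht)
  have hmonox : ∀ t : ℝ, 0 ≤ t → ∀ x ∈ Set.Icc (0:ℝ) 1, ∀ y ∈ Set.Icc (0:ℝ) 1, x ≤ y →
      Φ t x ≤ Φ t y := by
    intro t ht x hx y hy hxy
    exact hasSum_le (fun j => mul_le_mul_of_nonneg_left (pow_le_pow_left₀ hx.1 hxy j) (hPnn t ht j))
      (hΦ t ht x hx) (hΦ t ht y hy)
  obtain ⟨hanti, hdec⟩ := aux_decay (fun t => 1 - Φ t 0) (fun t => f (Φ t 0)) c hcpos
    (fun t ht => by have := (hmem t ht 0 h0m).2; simpa using this)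
    (fun t ht => (hfb _ (hmem t ht 0 h0m)).1)
    (fun t ht => (hKol 0 h0m t ht).const_sub 1)
  -- semigroup property
  have hsemi : ∀ τ : ℝ, 0 ≤ τ → ∀ t : ℝ, 0 ≤ t → Φ t (Φ τ 0) = Φ (t + τ) 0 := by
    intro τ hτ t ht
    have hd1 : ∀ s, 0 ≤ s → HasDerivAt (fun s => Φ s (Φ τ 0)) (f (Φ s (Φ τ 0))) s :=
      fun s hs => hKol _ (hmem τ hτ 0 h0m) s hs
    have hd2 : ∀ s, 0 ≤ s → HasDerivAt (fun s => Φ (s + τ) 0) (f (Φ (s + τ) 0)) s :=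
      fun s hs => (hKol 0 h0m (s + τ) (by linarith)).comp_add_const s τ
    have := ODE_solution_unique_of_mem_Icc_right (a := 0) (b := t) (v := fun _ => f)
      (s := fun _ => Set.Icc (0:ℝ) 1) (K := L)
      (f := fun s => Φ s (Φ τ 0)) (g := fun s => Φ (s + τ) 0)
      (fun _ _ => hL)
      (fun s hs => (hd1 s hs.1).continuousAt.continuousWithinAt)
      (fun s hs => (hd1 s hs.1).hasDerivWithinAt)
      (fun s hs => hmem s hs.1 _ (hmem τ hτ 0 h0m))
      (fun s hs => (hd2 s hs.1).continuousAt.continuousWithinAt)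
      (fun s hs => (hd2 s hs.1).hasDerivWithinAt)
      (fun s hs => hmem (s + τ) (by linarith [hs.1]) 0 h0m)
      (by simp [hΦ0 _ (hmem τ hτ 0 h0m)])
    exact this (Set.right_mem_Icc.2 ht)
  set K : ℝ := b / 2 / c ^ 3 with hK
  have hK0 : 0 ≤ K := by positivity
  have hdiff : ∀ t : ℝ, 0 < t → ∀ x ∈ Set.Ico (0:ℝ) 1,
      (Φ t x - Φ t 0) * (1 - x) ≤ K / t ^ 2 := by
    intro t ht x hx
    have hx1 : 0 < 1 - x := by linarith [hx.2]
    have hxm : x ∈ Set.Icc (0:ℝ) 1 := ⟨hx.1, hx.2.le⟩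
    set τ : ℝ := 1 / (c * (1 - x)) with hτ
    have hτ0 : 0 < τ := by positivity
    have h1 : x ≤ Φ τ 0 := by
      have := hdec τ hτ0
      have e : 1 / (c * τ) = 1 - x := by rw [hτ]; field_simp
      simp only [e] at this
      linarith
    have h2 : Φ t x ≤ Φ (t + τ) 0 := by
      rw [← hsemi τ hτ0.le t ht.le]
      exact hmonox t ht.le x hxm _ (hmem τ hτ0.le 0 h0m) h1
    have h3 : Φ (t + τ) 0 - Φ t 0 ≤ (b / 2 * (1 / (c * t)) ^ 2) * (t + τ - t) := by
      refine (convex_Icc t (t + τ)).image_sub_le_mul_sub_of_deriv_le (f := fun s => Φ s 0)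
        (fun s hs => (hKol 0 h0m s (ht.le.trans hs.1)).continuousAt.continuousWithinAt)
        (fun s hs => (hKol 0 h0m s
          (ht.le.trans (interior_subset hs).1)).differentiableAt.differentiableWithinAt)
        ?_ t (Set.left_mem_Icc.2 (by linarith)) _ (Set.right_mem_Icc.2 (by linarith)) (by linarith)
      intro s hs
      have hs' := interior_subset hs
      have hs0 : 0 ≤ s := ht.le.trans hs'.1
      rw [(hKol 0 h0m s hs0).deriv]
      refine (hfb _ (hmem s hs0 0 h0m)).2.trans ?_
      have h5 : 1 - Φ s 0 ≤ 1 / (c * t) := (hanti ht.le hs0 hs'.1).trans (hdec t ht)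
      have h6 : 0 ≤ 1 - Φ s 0 := by linarith [(hmem s hs0 0 h0m).2]
      gcongr
    calc (Φ t x - Φ t 0) * (1 - x) ≤ ((b / 2 * (1 / (c * t)) ^ 2) * (t + τ - t)) * (1 - x) := by
          refine mul_le_mul_of_nonneg_right (by linarith) hx1.le
      _ = K / t ^ 2 := by
          rw [hK, hτ]; field_simp; ring
  -- the coefficients
  have hpnn : ∀ t : ℝ, 0 ≤ t → ∀ j, 0 ≤ P t (j + 2) := fun t ht j => hPnn t ht _
  have hps : ∀ t : ℝ, 0 ≤ t → Summable (fun j => P t (j + 2)) := fun t ht =>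
    (summable_nat_add_iff 2).2 (hPsum t ht).summable
  have hG : ∀ t : ℝ, 0 ≤ t → ∀ s ∈ Set.Icc (0:ℝ) 1,
      (∑' j, P t (j + 2) * s ^ j) * s ^ 2 = Φ t s - P t 0 - P t 1 * s := by
    intro t ht s hs
    have h1 := (hΦ t ht s hs)
    rw [← hasSum_nat_add_iff' 2] at h1
    have h2 := (aux_summable _ (hpnn t ht) (hps t ht) s hs).hasSum.mul_right (s ^ 2)
    have h3 := h2.unique (a₂ := Φ t s - ∑ i ∈ Finset.range 2, P t i * s ^ i) (by
      exact h1.congr_fun (fun j => by ring))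
    rw [h3]
    simp [Finset.sum_range_succ]
    ring
  have hP0 : ∀ t : ℝ, 0 ≤ t → Φ t 0 = P t 0 := by
    intro t ht
    have := hG t ht 0 h0m
    simp at this
    linarith
  have hpart : ∀ t : ℝ, 0 < t → ∀ n : ℕ, ∀ s ∈ Set.Icc (0:ℝ) 1,
      (∑ j ∈ Finset.range n, P t (j + 2) * s ^ j) * (1 - s) ≤ 8 * K / t ^ 2 := by
    intro t ht n
    have hbig : ∀ s ∈ Set.Ico (1/2:ℝ) 1,
        (∑ j ∈ Finset.range n, P t (j + 2) * s ^ j) * (1 - s) ≤ 4 * (K / t ^ 2) := by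
      intro s hs
      have hs0 : 0 ≤ s := by linarith [hs.1]
      have hsm : s ∈ Set.Icc (0:ℝ) 1 := ⟨hs0, hs.2.le⟩
      have hs1 : 0 ≤ 1 - s := by linarith [hs.2]
      have h1 : ∑ j ∈ Finset.range n, P t (j + 2) * s ^ j ≤ ∑' j, P t (j + 2) * s ^ j :=
        (aux_summable _ (hpnn t ht.le) (hps t ht.le) s hsm).sum_le_tsum _
          (fun j _ => mul_nonneg (hpnn t ht.le j) (pow_nonneg hs0 j))
      have h2 := hG t ht.le s hsm
      have h3 := hdiff t ht s ⟨hs0, hs.2⟩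
      have h4 : 0 ≤ ∑' j, P t (j + 2) * s ^ j :=
        tsum_nonneg (fun j => mul_nonneg (hpnn t ht.le j) (pow_nonneg hs0 j))
      have h5 := mul_nonneg (hPnn t ht.le 1) hs0
      rw [hP0 t ht.le] at h3
      have hq : 1 ≤ 4 * s ^ 2 := by nlinarith [hs.1]
      have h6 : (∑' j, P t (j + 2) * s ^ j) ≤ 4 * (Φ t s - P t 0) := by nlinarith
      calc _ ≤ (4 * (Φ t s - P t 0)) * (1 - s) :=
            mul_le_mul_of_nonneg_right (h1.trans h6) hs1
        _ ≤ _ := by linarith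
    intro s hs
    have hKt : 0 ≤ K / t ^ 2 := by positivity
    have e8 : 8 * K / t ^ 2 = 8 * (K / t ^ 2) := by ring
    rw [e8]
    rcases lt_or_ge s (1/2) with h | h
    · have h1 := hbig (1/2) ⟨le_rfl, by norm_num⟩
      have h2 : ∑ j ∈ Finset.range n, P t (j + 2) * s ^ j
          ≤ ∑ j ∈ Finset.range n, P t (j + 2) * (1/2) ^ j :=
        Finset.sum_le_sum fun j _ => mul_le_mul_of_nonneg_left
          (pow_le_pow_left₀ hs.1 h.le j) (hpnn t ht.le j)
      have h3 : 0 ≤ ∑ j ∈ Finset.range n, P t (j + 2) * s ^ j :=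
        Finset.sum_nonneg fun j _ => mul_nonneg (hpnn t ht.le j) (pow_nonneg hs.1 j)
      nlinarith [hs.1, mul_nonneg h3 hs.1]
    · rcases hs.2.eq_or_lt with h1 | h1
      · rw [h1]; simp; positivity
      · linarith [hbig s ⟨h, h1⟩]
  -- the inner integrand
  have hin : ∀ t : ℝ, 0 < t → ∀ x ∈ Set.Icc (0:ℝ) 1,
      Set.EqOn (fun s : ℝ => ∑' j, P t (j + 2) * s ^ j)
        (fun s : ℝ => (Φ t s - P t 0 - P t 1 * s) / s / s) (Set.uIoc 0 x) := by
    intro t ht x hx s hs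
    rw [Set.uIoc_of_le hx.1] at hs
    have hsne : s ≠ 0 := hs.1.ne'
    simp only
    rw [← hG t ht.le s ⟨hs.1.le, hs.2.trans hx.2⟩]
    field_simp
  have hqnn : ∀ t : ℝ, 0 ≤ t → ∀ j : ℕ, 0 ≤ P t (j + 2) / ((j : ℝ) + 1) :=
    fun t ht j => div_nonneg (hpnn t ht j) (by positivity)
  have hqs : ∀ t : ℝ, 0 ≤ t → Summable (fun j : ℕ => P t (j + 2) / ((j : ℝ) + 1)) := fun t ht =>
    (hps t ht).of_nonneg_of_le (hqnn t ht) (fun j => div_le_self (hpnn t ht j)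
      (by have : (0:ℝ) ≤ j := Nat.cast_nonneg j
          linarith))
  have hout : ∀ t : ℝ, 0 < t →
      Set.EqOn (fun x : ℝ => ∑' j : ℕ, P t (j + 2) / ((j : ℝ) + 1) * x ^ j)
        (fun x : ℝ => (∫ s in (0:ℝ)..x, (Φ t s - P t 0 - P t 1 * s) / s / s) / x)
        (Set.uIoc 0 1) := by
    intro t ht x hx
    rw [Set.uIoc_of_le zero_le_one] at hx
    have hxm : x ∈ Set.Icc (0:ℝ) 1 := ⟨hx.1.le, hx.2⟩
    have h1 := intervalIntegral.integral_congr_ae (μ := MeasureTheory.volume)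
      (Filter.Eventually.of_forall (hin t ht x hxm))
    have h2 := (aux_integral _ (hpnn t ht.le) (hps t ht.le) x hxm).div_const x
    simp only
    rw [← h1, ← h2.tsum_eq]
    refine tsum_congr fun j => ?_
    have := hx.1.ne'
    rw [pow_succ]
    field_simp
  have hval : ∀ t : ℝ, 0 < t →
      HasSum (fun j : ℕ => P t (j + 2) / ((j : ℝ) + 1) / ((j : ℝ) + 1))
      (∫ x in (0:ℝ)..1, (∫ s in (0:ℝ)..x, (Φ t s - P t 0 - P t 1 * s) / s / s) / x) := by
    intro t ht
    have h1 := intervalIntegral.integral_congr_ae (μ := MeasureTheory.volume)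
      (Filter.Eventually.of_forall (hout t ht))
    rw [← h1]
    simpa using aux_integral _ (hqnn t ht.le) (hqs t ht.le) 1 ⟨zero_le_one, le_rfl⟩
  refine ⟨?_, ?_, ?_⟩
  · intro t ht x hx
    refine (intervalIntegrable_congr (hin t ht x hx)).1 ?_
    refine ContinuousOn.intervalIntegrable ?_
    rw [Set.uIcc_of_le hx.1]
    exact (aux_cont _ (hpnn t ht.le) (hps t ht.le)).mono (Set.Icc_subset_Icc_right hx.2)
  · intro t ht
    refine (intervalIntegrable_congr (hout t ht)).1 ?_
    refine ContinuousOn.intervalIntegrable ?_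
    rw [Set.uIcc_of_le zero_le_one]
    exact aux_cont _ (hqnn t ht.le) (hqs t ht.le)
  · refine Asymptotics.IsBigO.of_bound (b * (2 * (8 * K))) ?_
    filter_upwards [Filter.eventually_ge_atTop (Real.exp 1)] with t ht
    have ht0 : 0 < t := (Real.exp_pos 1).trans_le ht
    have hlog : 1 ≤ Real.log t := by rwa [Real.le_log_iff_exp_le ht0]
    have hJ := hval t ht0
    have hnn : ∀ j : ℕ, 0 ≤ P t (j + 2) / ((j : ℝ) + 1) / ((j : ℝ) + 1) :=
      fun j => div_nonneg (hqnn t ht0.le j) (by positivity)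
    have hle := Real.tsum_le_of_sum_range_le hnn (fun n =>
      aux_weight _ (hpnn t ht0.le) (8 * K / t ^ 2) n (hpart t ht0 n))
    rw [hJ.tsum_eq] at hle
    have hJ0 := hJ.nonneg hnn
    rw [Real.norm_of_nonneg (mul_nonneg hb0 hJ0), Real.norm_of_nonneg (by positivity)]
    calc _ ≤ b * (2 * (8 * K / t ^ 2)) := mul_le_mul_of_nonneg_left hle hb0
      _ = b * (2 * (8 * K)) * (1 / t ^ 2) := by ring
      _ ≤ _ := by gcongr
end

section
/- In the noncritical case, for every fixed x ∈ [0,1) the generating function of the Markov Q-process converges: Σ_{j≥1} Q_{1j}(t)·x^j → x·exp(∫_{qx}^q (f'(s) − f'(q))/f(s) ds) as t → ∞. -/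
open scoped Topology

lemma aux_tangent (s q : ℝ) (hs : 0 ≤ s) (hq : 0 ≤ q) (n : ℕ) :
    0 ≤ s ^ n - q ^ n - n * q ^ (n - 1) * (s - q) := by
  induction n with
  | zero => simp
  | succ n ih =>
    rcases Nat.eq_zero_or_pos n with h | h
    · subst h; simp
    · obtain ⟨m, rfl⟩ : ∃ m, n = m + 1 := ⟨n - 1, by omega⟩
      simp only [Nat.add_sub_cancel] at ih ⊢
      have h1 := mul_nonneg hs ih
      have h2 : 0 ≤ ((m : ℝ) + 1) * q ^ m * (s - q) ^ 2 := by positivity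
      push_cast at *
      ring_nf at *
      linarith

lemma aux_deriv (c : ℕ → ℝ) (r : ℝ) (hr : 0 < r)
    (hc : Summable fun k : ℕ => |(k : ℝ) * c k * r ^ (k - 1)|) (y : ℝ) (hy : |y| < r) :
    HasDerivAt (fun x => ∑' k, c k * x ^ k) (∑' k : ℕ, (k : ℝ) * c k * y ^ (k - 1)) y := by
  refine hasDerivAt_tsum_of_isPreconnected (t := Set.Ioo (-r) r) (y₀ := 0)
    (g := fun k x => c k * x ^ k) (g' := fun k x => (k : ℝ) * c k * x ^ (k - 1)) hc isOpen_Ioo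
    isPreconnected_Ioo ?_ ?_ ?_ ?_ (abs_lt.mp hy)
  · intro k x _
    have := (hasDerivAt_pow k x).const_mul (c k)
    exact this.congr_deriv (by ring)
  · intro k x hx
    have hx' : |x| ≤ r := (abs_lt.mpr hx).le
    rw [Real.norm_eq_abs, abs_mul, abs_mul _ (r ^ _), abs_pow, abs_pow, abs_of_pos hr]
    gcongr
  · exact ⟨by linarith, hr⟩
  · apply summable_of_ne_finset_zero (s := {0})
    intro k hk
    simp at hk
    simp [hk]

lemma aux_const (g : ℝ → ℝ) (h : ∀ t, 0 ≤ t → HasDerivAt g 0 t) (t : ℝ) (ht : 0 ≤ t) :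
    g t = g 0 :=
  constant_of_has_deriv_right_zero (a := 0) (b := t)
    (fun s hs => (h s hs.1).continuousAt.continuousWithinAt)
    (fun s hs => (h s hs.1).hasDerivWithinAt) t ⟨ht, le_rfl⟩

lemma aux_mono (g g' : ℝ → ℝ) (h : ∀ t, 0 ≤ t → HasDerivAt g (g' t) t)
    (h' : ∀ t, 0 ≤ t → 0 ≤ g' t) (t : ℝ) (ht : 0 ≤ t) : g 0 ≤ g t := by
  have : MonotoneOn g (Set.Ici 0) := by
    apply monotoneOn_of_deriv_nonneg (convex_Ici 0)
    · exact fun s hs => (h s hs).continuousAt.continuousWithinAt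
    · intro s hs
      rw [interior_Ici] at hs
      exact (h s (le_of_lt hs)).differentiableAt.differentiableWithinAt
    · intro s hs
      rw [interior_Ici] at hs
      rw [(h s (le_of_lt hs)).deriv]
      exact h' s (le_of_lt hs)
  exact this (Set.mem_Ici.2 le_rfl) ht ht

theorem stmt_14
    (a : ℕ → ℝ) (f : ℝ → ℝ) (P : ℝ → ℕ → ℝ) (Φ : ℝ → ℝ → ℝ)
    (ha : ∀ k : ℕ, k ≠ 1 → 0 ≤ a k)
    (ha0 : 0 < a 0)
    (ha1 : HasSum (fun k : ℕ => if k = 1 then (0:ℝ) else a k) (-(a 1)))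
    (ha01 : a 0 < -(a 1))
    (hf : ∀ x ∈ Set.Icc (0:ℝ) 1, HasSum (fun k : ℕ => a k * x ^ k) (f x))
    (hPnn : ∀ t : ℝ, 0 ≤ t → ∀ j : ℕ, 0 ≤ P t j)
    (hPsum : ∀ t : ℝ, 0 ≤ t → HasSum (fun j : ℕ => P t j) 1)
    (hΦ : ∀ t : ℝ, 0 ≤ t → ∀ x ∈ Set.Icc (0:ℝ) 1, HasSum (fun j : ℕ => P t j * x ^ j) (Φ t x))
    (hΦ0 : ∀ x ∈ Set.Icc (0:ℝ) 1, Φ 0 x = x)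
    (hKol : ∀ x ∈ Set.Icc (0:ℝ) 1, ∀ t : ℝ, 0 ≤ t → HasDerivAt (fun s => Φ s x) (f (Φ t x)) t)
    (m : ℝ)
    (hm : HasSum (fun k : ℕ => (k : ℝ) * a k) m)
    (hnoncrit : m ≠ 0)
    (q fq β : ℝ)
    (hq : q = sInf {x : ℝ | x ∈ Set.Icc (0:ℝ) 1 ∧ f x = 0})
    (hfq : HasSum (fun k : ℕ => (k : ℝ) * a k * q ^ (k - 1)) fq)
    (hβ : β = Real.exp fq)
    (hβlt : β < 1)
    (b : ℝ)
    (hb : HasSum (fun k : ℕ => (k : ℝ) * ((k : ℝ) - 1) * a k * q ^ (k - 1)) b)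
    (df : ℝ → ℝ)
    (hdf : ∀ x ∈ Set.Icc (0:ℝ) 1, HasSum (fun k : ℕ => (k : ℝ) * a k * x ^ (k - 1)) (df x))
    :
    ∀ x : ℝ, 0 ≤ x → x < 1 →
      Filter.Tendsto (fun t : ℝ => ∑' j : ℕ, (j : ℝ) * q ^ (j - 1) * P t j / β ^ t * x ^ j)
        Filter.atTop (𝓝 (x * Real.exp (∫ s in (q * x)..q, (df s - fq) / f s))) := by
  -- basic facts
  have h01 : (1:ℝ) ∈ Set.Icc (0:ℝ) 1 := ⟨zero_le_one, le_rfl⟩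
  have hka : Summable fun k : ℕ => |(k : ℝ) * a k| := hm.summable.abs
  have haa : Summable fun k : ℕ => |a k| := by
    have := (hf 1 h01).summable.abs
    simpa using this
  have hf1 : f 1 = 0 := by
    have h2 : HasSum (fun k : ℕ => if k = 1 then a 1 else 0) (a 1) := hasSum_ite_eq 1 (a 1)
    have h3 := ha1.add h2
    have h4 := hf 1 h01
    have h5 : (fun k : ℕ => (if k = 1 then (0:ℝ) else a k) + (if k = 1 then a 1 else 0))
        = fun k => a k * 1 ^ k := by
      funext k
      by_cases hk : k = 1 <;> simp [hk]
    rw [h5] at h3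
    have := h4.unique h3
    linarith
  have hfcont : ContinuousOn f (Set.Icc 0 1) := by
    have : ContinuousOn (fun x : ℝ => ∑' k, a k * x ^ k) (Set.Icc 0 1) := by
      apply continuousOn_tsum (u := fun k => |a k|)
      · intro k; fun_prop
      · exact haa
      · intro k x hx
        rw [Real.norm_eq_abs, abs_mul, abs_pow, abs_of_nonneg hx.1]
        exact mul_le_of_le_one_right (abs_nonneg _) (pow_le_one₀ hx.1 hx.2)
    exact this.congr fun x hx => (hf x hx).tsum_eq.symm
  have hdfcont : ContinuousOn df (Set.Icc 0 1) := by
    have : ContinuousOn (fun x : ℝ => ∑' k : ℕ, (k : ℝ) * a k * x ^ (k - 1)) (Set.Icc 0 1) := by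
      apply continuousOn_tsum (u := fun k : ℕ => |(k : ℝ) * a k|)
      · intro k; fun_prop
      · exact hka
      · intro k x hx
        rw [Real.norm_eq_abs, abs_mul, abs_pow, abs_of_nonneg hx.1]
        exact mul_le_of_le_one_right (abs_nonneg _) (pow_le_one₀ hx.1 hx.2)
    exact this.congr fun x hx => (hdf x hx).tsum_eq.symm
  have hqS : q ∈ {x : ℝ | x ∈ Set.Icc (0:ℝ) 1 ∧ f x = 0} := by
    rw [hq]
    apply IsClosed.csInf_mem
    · exact hfcont.preimage_isClosed_of_isClosed isClosed_Icc isClosed_singleton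
    · exact ⟨1, h01, hf1⟩
    · exact ⟨0, fun x hx => hx.1.1⟩
  obtain ⟨hqI, hfq0⟩ := hqS
  have hf0 : f 0 = a 0 := by
    refine (hf 0 ⟨le_rfl, zero_le_one⟩).unique ?_
    convert hasSum_ite_eq 0 (a 0) using 2 with k
    by_cases hk : k = 0 <;> simp [hk]
  have hqpos : 0 < q := by
    rcases hqI.1.eq_or_lt with h | h
    · rw [← h, hf0] at hfq0; linarith
    · exact h
  have hfqneg : fq < 0 := by
    rw [hβ] at hβlt
    simpa using hβlt
  have hdfq : df q = fq := (hdf q hqI).unique hfq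
  -- tangent inequality
  have htan : ∀ s ∈ Set.Icc (0:ℝ) 1, (-fq) * (q - s) ≤ f s := by
    intro s hs
    have h1 := ((hf s hs).sub (hf q hqI)).sub (hfq.mul_right (s - q))
    have h2 : 0 ≤ f s - f q - fq * (s - q) := by
      refine h1.nonneg fun k => ?_
      by_cases hk : k = 1
      · subst hk; simp; linarith
      · have := mul_nonneg (ha k hk) (aux_tangent s q hs.1 hqI.1 k)
        linarith
    rw [hfq0] at h2
    linarith
  have hfpos : ∀ s, 0 ≤ s → s < q → 0 < f s := by
    intro s hs hsq
    have := htan s ⟨hs, by linarith [hqI.2]⟩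
    have : 0 < (-fq) * (q - s) := mul_pos (by linarith) (by linarith)
    linarith
  -- derivative of f
  have hfder : ∀ s, 0 < s → s < 1 → HasDerivAt f (df s) s := by
    intro s hs0 hs1
    have h1 := aux_deriv a 1 one_pos (by simpa using hka) s (by rw [abs_of_pos hs0]; exact hs1)
    rw [(hdf s ⟨hs0.le, hs1.le⟩).tsum_eq] at h1
    refine h1.congr_of_eventuallyEq ?_
    filter_upwards [Ioo_mem_nhds hs0 hs1] with x hx
    exact (hf x ⟨hx.1.le, hx.2.le⟩).tsum_eq.symm
  -- Lipschitz
  obtain ⟨L, hL⟩ := hka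
  have hLip : ∀ u ∈ Set.Icc (0:ℝ) 1, (q - u) * f u ≤ L * (q - u) ^ 2 := by
    intro u hu
    have h1 := ((hf u hu).sub (hf q hqI)).mul_left (q - u)
    rw [hfq0, sub_zero] at h1
    refine hasSum_le (fun k => ?_) h1 (hL.mul_right ((q - u) ^ 2))
    have h2 : |u ^ k - q ^ k| ≤ k * |q - u| := by
      have h3 := abs_pow_sub_pow_le u q k
      have h4 : max |u| |q| ^ (k - 1) ≤ 1 := by
        apply pow_le_one₀ (by positivity)
        rw [abs_of_nonneg hu.1, abs_of_nonneg hqI.1]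
        exact max_le hu.2 hqI.2
      calc |u ^ k - q ^ k| ≤ |u - q| * k * max |u| |q| ^ (k - 1) := h3
        _ ≤ |u - q| * k * 1 := by gcongr
        _ = k * |q - u| := by rw [abs_sub_comm]; ring
    calc (q - u) * (a k * u ^ k - a k * q ^ k) ≤ |(q - u) * (a k * u ^ k - a k * q ^ k)| := le_abs_self _
      _ = |q - u| * |a k| * |u ^ k - q ^ k| := by rw [← mul_sub, abs_mul, abs_mul]; ring
      _ ≤ |q - u| * |a k| * (k * |q - u|) := by gcongr
      _ = |(k : ℝ) * a k| * (q - u) ^ 2 := by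
        rw [abs_mul, Nat.abs_cast, ← sq_abs (q - u)]; ring
  -- Φ in the unit interval
  have hΦI : ∀ t, 0 ≤ t → ∀ z ∈ Set.Icc (0:ℝ) 1, Φ t z ∈ Set.Icc (0:ℝ) 1 := by
    intro t ht z hz
    have h := hΦ t ht z hz
    refine ⟨h.nonneg fun j => mul_nonneg (hPnn t ht j) (pow_nonneg hz.1 j), ?_⟩
    exact hasSum_le (fun j => mul_le_of_le_one_right (hPnn t ht j) (pow_le_one₀ hz.1 hz.2)) h (hPsum t ht)
  -- Φ t z < q
  have hΦlt : ∀ z, 0 ≤ z → z < q → ∀ t, 0 ≤ t → Φ t z < q := by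
    intro z hz0 hzq
    have hz : z ∈ Set.Icc (0:ℝ) 1 := ⟨hz0, by linarith [hqI.2]⟩
    have hne : ∀ t, 0 ≤ t → Φ t z ≠ q := by
      intro t ht heq
      have h1 := aux_mono (fun t => (q - Φ t z) ^ 2 * Real.exp (2 * L * t))
        (fun t => 2 * (L * (q - Φ t z) ^ 2 - (q - Φ t z) * f (Φ t z)) * Real.exp (2 * L * t)) ?_ ?_ t ht
      · simp only [heq, hΦ0 z hz] at h1
        have : 0 < (q - z) ^ 2 := by have : 0 < q - z := by linarith
                                     positivity
        simp at h1
        linarith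
      · intro t ht
        have e1 := ((hKol z hz t ht).const_sub q).pow 2
        have e2 := ((hasDerivAt_id t).const_mul (2 * L)).exp
        refine (e1.mul e2).congr_deriv ?_
        simp
        ring
      · intro t ht
        have := hLip _ (hΦI t ht z hz)
        have := Real.exp_pos (2 * L * t)
        apply mul_nonneg _ this.le
        linarith
    intro t ht
    by_contra hcon
    push Not at hcon
    have hc : ContinuousOn (fun s => Φ s z) (Set.Icc 0 t) :=
      fun s hs => (hKol z hz s hs.1).continuousAt.continuousWithinAt
    have := intermediate_value_Icc ht hc
    obtain ⟨s, hs, hs'⟩ := this (show q ∈ Set.Icc _ _ from ⟨by simp only [hΦ0 z hz]; exact hzq.le, hcon⟩)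
    exact hne s hs.1 hs'
  have hΦge : ∀ z, 0 ≤ z → z < q → ∀ t, 0 ≤ t → z ≤ Φ t z := by
    intro z hz0 hzq t ht
    have hz : z ∈ Set.Icc (0:ℝ) 1 := ⟨hz0, by linarith [hqI.2]⟩
    have := aux_mono (fun t => Φ t z) (fun t => f (Φ t z)) (hKol z hz)
      (fun t ht => (hfpos _ (hΦI t ht z hz).1 (hΦlt z hz0 hzq t ht)).le) t ht
    simpa [hΦ0 z hz] using this
  have hΦtend : ∀ z, 0 ≤ z → z < q → Filter.Tendsto (fun t => Φ t z) Filter.atTop (𝓝 q) := by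
    intro z hz0 hzq
    have hz : z ∈ Set.Icc (0:ℝ) 1 := ⟨hz0, by linarith [hqI.2]⟩
    have hlow : ∀ t, 0 ≤ t → q - (q - z) * Real.exp (fq * t) ≤ Φ t z := by
      intro t ht
      have h1 := aux_mono (fun t => (Φ t z - q) * Real.exp (-fq * t))
        (fun t => (f (Φ t z) - (-fq) * (q - Φ t z)) * Real.exp (-fq * t)) ?_ ?_ t ht
      · simp only [hΦ0 z hz, mul_zero, Real.exp_zero, mul_one] at h1
        have h2 := mul_le_mul_of_nonneg_right h1 (Real.exp_pos (fq * t)).le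
        rw [mul_assoc, ← Real.exp_add] at h2
        have h3 : -fq * t + fq * t = 0 := by ring
        rw [h3, Real.exp_zero] at h2
        linarith
      · intro t ht
        have e1 := (hKol z hz t ht).sub_const q
        have e2 := ((hasDerivAt_id t).const_mul (-fq)).exp
        refine (e1.mul e2).congr_deriv ?_
        simp
        ring
      · intro t ht
        have := htan _ (hΦI t ht z hz)
        exact mul_nonneg (by linarith) (Real.exp_pos _).le
    have hlim : Filter.Tendsto (fun t => q - (q - z) * Real.exp (fq * t)) Filter.atTop (𝓝 q) := by
      have h1 : Filter.Tendsto (fun t => Real.exp (fq * t)) Filter.atTop (𝓝 0) :=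
        Real.tendsto_exp_atBot.comp (Filter.tendsto_id.const_mul_atTop_of_neg hfqneg)
      simpa using (h1.const_mul (q - z)).const_sub q
    refine tendsto_of_tendsto_of_tendsto_of_le_of_le' hlim tendsto_const_nhds ?_ ?_
    · filter_upwards [Filter.eventually_ge_atTop 0] with t ht using hlow t ht
    · filter_upwards [Filter.eventually_ge_atTop 0] with t ht using (hΦlt z hz0 hzq t ht).le
  intro x hx0 hx1
  rcases hx0.eq_or_lt with hx | hxpos
  · subst hx
    have : ∀ t : ℝ, ∑' j : ℕ, (j : ℝ) * q ^ (j - 1) * P t j / β ^ t * (0:ℝ) ^ j = 0 := by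
      intro t
      rw [← tsum_zero (α := ℝ) (β := ℕ)]
      congr 1
      funext j
      by_cases hj : j = 0 <;> simp [hj]
    simp only [this, zero_mul]
    exact tendsto_const_nhds
  obtain ⟨y, hy⟩ : ∃ y, y = q * x := ⟨_, rfl⟩
  have hy0 : 0 < y := by rw [hy]; positivity
  have hyq : y < q := by rw [hy]; nlinarith
  have hyI : y ∈ Set.Icc (0:ℝ) 1 := ⟨hy0.le, by linarith [hqI.2]⟩
  rw [← hy]
  have hfy := hfpos y hy0.le hyq
  -- primitives
  have hprim : ∀ g : ℝ → ℝ, ContinuousOn g (Set.Ioo 0 q) → ∀ u, 0 < u → u < q →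
      HasDerivAt (fun w => ∫ s in y..w, g s) (g u) u := by
    intro g hg u hu0 huq
    apply intervalIntegral.integral_hasDerivAt_right
    · apply ContinuousOn.intervalIntegrable
      apply hg.mono
      intro w hw
      rw [Set.mem_uIcc] at hw
      rcases hw with hw | hw
      · exact ⟨by linarith [hw.1], by linarith [hw.2]⟩
      · exact ⟨by linarith [hw.1], by linarith [hw.2]⟩
    · exact hg.stronglyMeasurableAtFilter isOpen_Ioo u ⟨hu0, huq⟩
    · exact hg.continuousAt (Ioo_mem_nhds hu0 huq)
  have hsub : Set.Ioo (0:ℝ) q ⊆ Set.Icc 0 1 := fun w hw => ⟨hw.1.le, by linarith [hw.2, hqI.2]⟩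
  have hfne : ∀ w ∈ Set.Ioo (0:ℝ) q, f w ≠ 0 := fun w hw => (hfpos w hw.1.le hw.2).ne'
  have hc1 : ContinuousOn (fun s => 1 / f s) (Set.Ioo 0 q) :=
    continuousOn_const.div (hfcont.mono hsub) hfne
  have hc2 : ContinuousOn (fun s => (df s - fq) / f s) (Set.Ioo 0 q) :=
    ((hdfcont.mono hsub).sub continuousOn_const).div (hfcont.mono hsub) hfne
  have hG := hprim _ hc1
  have hH := hprim _ hc2
  have hrange : ∀ z, 0 < z → z < q → ∀ t, 0 ≤ t → 0 < Φ t z ∧ Φ t z < q := fun z hz hzq t ht =>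
    ⟨hz.trans_le (hΦge z hz.le hzq t ht), hΦlt z hz.le hzq t ht⟩
  -- flow identity
  have hflow : ∀ z, 0 < z → z < q → ∀ t, 0 ≤ t →
      (∫ s in y..Φ t z, 1 / f s) = (∫ s in y..z, 1 / f s) + t := by
    intro z hz0 hzq t ht
    have hz : z ∈ Set.Icc (0:ℝ) 1 := hsub ⟨hz0, hzq⟩
    have h1 := aux_const (fun t => (∫ s in y..Φ t z, 1 / f s) - t) ?_ t ht
    · simp only [hΦ0 z hz, sub_zero] at h1
      linarith
    · intro t ht
      obtain ⟨r1, r2⟩ := hrange z hz0 hzq t ht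
      have e := ((hG _ r1 r2).comp t (hKol z hz t ht)).sub (hasDerivAt_id t)
      refine e.congr_deriv ?_
      have := hfne _ ⟨r1, r2⟩
      field_simp
      ring
  -- derivative of Φ in the space variable
  have hΦy : ∀ t, 0 ≤ t → ∑' j : ℕ, (j : ℝ) * P t j * y ^ (j - 1) = f (Φ t y) / f y := by
    intro t ht
    obtain ⟨r, hr1, hr2⟩ := exists_between (show y < 1 by linarith [hqI.2])
    have hr0 : 0 < r := by linarith
    have hsum : Summable fun k : ℕ => |(k : ℝ) * P t k * r ^ (k - 1)| := by
      have h1 : Summable fun k : ℕ => (k : ℝ) * r ^ (k - 1) := by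
        have h2 := (summable_pow_mul_geometric_of_norm_lt_one 1
          (show ‖r‖ < 1 by rw [Real.norm_eq_abs, abs_of_pos hr0]; exact hr2)).mul_right r⁻¹
        refine h2.congr fun k => ?_
        rcases k with _ | k
        · simp
        · simp [pow_succ, hr0.ne', mul_assoc]
      refine Summable.of_nonneg_of_le (fun _ => abs_nonneg _) (fun k => ?_) h1
      have hP1 : P t k ≤ 1 := le_hasSum (hPsum t ht) k (fun j _ => hPnn t ht j)
      have hP0 := hPnn t ht k
      rw [abs_of_nonneg (by positivity)]
      have : (k : ℝ) * P t k ≤ k := mul_le_of_le_one_right (Nat.cast_nonneg k) hP1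
      gcongr
    have h1 := aux_deriv (P t) r hr0 hsum y (by rw [abs_of_pos hy0]; exact hr1)
    have h2 : HasDerivAt (fun z => Φ t z) (∑' j : ℕ, (j : ℝ) * P t j * y ^ (j - 1)) y := by
      refine h1.congr_of_eventuallyEq ?_
      filter_upwards [Ioo_mem_nhds hy0 hyq] with z hz
      exact (hΦ t ht z (hsub hz)).tsum_eq.symm
    obtain ⟨r1, r2⟩ := hrange y hy0 hyq t ht
    have h3 := (hG _ r1 r2).comp y h2
    have h4 := (hG y hy0 hyq).add_const t
    have h5 := h4.congr_of_eventuallyEq (f₁ := (fun w => ∫ s in y..w, 1 / f s) ∘ fun z => Φ t z) (by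
      filter_upwards [Ioo_mem_nhds hy0 hyq] with z hz
      exact hflow z hz.1 hz.2 t ht)
    have h6 := h3.unique h5
    have h7 := hfne _ ⟨r1, r2⟩
    field_simp at h6 ⊢
    linarith
  -- identity for f (Φ t y)
  have hid : ∀ t, 0 ≤ t → f (Φ t y) / f y / Real.exp (fq * t)
      = Real.exp (∫ s in y..Φ t y, (df s - fq) / f s) := by
    intro t ht
    have h1 := aux_const (fun t => f (Φ t y) *
      Real.exp (-(fq * t) - ∫ s in y..Φ t y, (df s - fq) / f s)) ?_ t ht
    · simp only [hΦ0 y hyI, intervalIntegral.integral_same, mul_zero, sub_zero, neg_zero,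
        Real.exp_zero, mul_one] at h1
      rw [Real.exp_sub, Real.exp_neg] at h1
      have := Real.exp_pos (fq * t)
      have := Real.exp_pos (∫ s in y..Φ t y, (df s - fq) / f s)
      field_simp at h1 ⊢
      linarith
    · intro t ht
      obtain ⟨r1, r2⟩ := hrange y hy0 hyq t ht
      have k := hKol y hyI t ht
      have e1 := (hfder _ r1 (by linarith [hqI.2])).comp t k
      have e2 := ((((hasDerivAt_id t).const_mul fq).neg).sub ((hH _ r1 r2).comp t k)).exp
      refine (e1.mul e2).congr_deriv ?_
      have := hfne _ ⟨r1, r2⟩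
      simp
      field_simp
      ring
  -- integrability up to q
  have hint : IntervalIntegrable (fun s => (df s - fq) / f s) MeasureTheory.volume y q := by
    rw [intervalIntegrable_iff_integrableOn_Ioo_of_le hyq.le]
    have hsub' : Set.Ioo y q ⊆ Set.Ioo 0 q := Set.Ioo_subset_Ioo_left hy0.le
    refine MeasureTheory.IntegrableOn.of_bound (C := b / (q * (-fq))) (by simp)
      ((hc2.mono hsub').aestronglyMeasurable measurableSet_Ioo) ?_
    rw [MeasureTheory.ae_restrict_iff' measurableSet_Ioo]
    refine Filter.Eventually.of_forall fun s hs => ?_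
    have hsI := hsub (hsub' hs)
    have hqs : 0 < q - s := by linarith [hs.2]
    have hterm : ∀ k : ℕ, 0 ≤ (k : ℝ) * a k * q ^ (k - 1) - (k : ℝ) * a k * s ^ (k - 1) ∧
        q * ((k : ℝ) * a k * q ^ (k - 1) - (k : ℝ) * a k * s ^ (k - 1)) ≤
        (q - s) * ((k : ℝ) * ((k : ℝ) - 1) * a k * q ^ (k - 1)) := by
      intro k
      rcases k with _ | _ | k
      · simp
      · simp
      · have hak := ha (k + 2) (by omega)
        have hkn : (0:ℝ) ≤ ((k + 2 : ℕ) : ℝ) * a (k + 2) := by positivity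
        have h1 := aux_tangent s q hsI.1 hqI.1 (k + 1)
        have h2 : s ^ (k + 1) ≤ q ^ (k + 1) := pow_le_pow_left₀ hsI.1 hs.2.le _
        constructor
        · rw [← mul_sub]
          exact mul_nonneg hkn (by simpa using h2)
        · have h3 := mul_nonneg (mul_nonneg hqI.1 hkn) h1
          simp only [Nat.add_sub_cancel] at h3
          have e1 : k + 1 + 1 - 1 = k + 1 := rfl
          rw [e1]
          push_cast at *
          ring_nf at *
          linarith
    have hd := (hfq.sub (hdf s hsI))
    have hd0 : 0 ≤ fq - df s := hd.nonneg fun k => (hterm k).1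
    have hd1 : q * (fq - df s) ≤ (q - s) * b :=
      hasSum_le (fun k => (hterm k).2) (hd.mul_left q) (hb.mul_left (q - s))
    have ht := htan s hsI
    have hfs := hfpos s hsI.1 hs.2
    rw [Real.norm_eq_abs, abs_div, abs_of_pos hfs, abs_of_nonpos (by linarith),
      div_le_div_iff₀ hfs (mul_pos hqpos (by linarith))]
    have hb0 : 0 ≤ b := by
      by_contra hcon
      push Not at hcon
      have := mul_nonneg hqI.1 hd0
      have := mul_neg_of_pos_of_neg hqs hcon
      linarith
    have s1 := mul_le_mul_of_nonneg_right hd1 (show 0 ≤ -fq by linarith)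
    have s2 := mul_le_mul_of_nonneg_left ht hb0
    linarith
  have hcont : ContinuousOn (fun w => ∫ s in y..w, (df s - fq) / f s) (Set.Icc y q) := by
    have := intervalIntegral.continuousOn_primitive_interval (a := y) (b := q)
      (μ := MeasureTheory.volume) (f := fun s => (df s - fq) / f s)
      (by rw [Set.uIcc_of_le hyq.le]; exact (intervalIntegrable_iff_integrableOn_Icc_of_le hyq.le).1 hint)
    rwa [Set.uIcc_of_le hyq.le] at this
  have hlim : Filter.Tendsto (fun t => ∫ s in y..Φ t y, (df s - fq) / f s) Filter.atTop
      (𝓝 (∫ s in y..q, (df s - fq) / f s)) := by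
    refine (hcont q ⟨hyq.le, le_rfl⟩).tendsto.comp
      (tendsto_nhdsWithin_iff.2 ⟨hΦtend y hy0.le hyq, ?_⟩)
    filter_upwards [Filter.eventually_ge_atTop 0] with t ht
    exact ⟨hΦge y hy0.le hyq t ht, (hΦlt y hy0.le hyq t ht).le⟩
  refine (((Real.continuous_exp.tendsto _).comp hlim).const_mul x).congr' ?_
  filter_upwards [Filter.eventually_ge_atTop 0] with t ht
  have hβt : β ^ t = Real.exp (fq * t) := by rw [hβ, ← Real.exp_mul]
  simp only [Function.comp]
  rw [← hid t ht, ← hΦy t ht, hβt, div_eq_mul_inv, ← tsum_mul_right, ← tsum_mul_left]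
  congr 1
  funext j
  rcases j with _ | j
  · simp
  · simp only [Nat.add_sub_cancel, hy, mul_pow, pow_succ]
    ring
end

section
/- In the noncritical case, the limit generating function κ(x) := exp(∫_x^1 (f'(qs) − f'(q))·q/f(qs) ds) satisfies the local expansion κ(x) = 1 − γ·(1−x) + o(1−x) as x ↑ 1, where γ = b/|ln β|. -/
open scoped Topology

theorem aux_cont_s15 (c : ℕ → ℝ) (e : ℕ → ℕ) (F : ℝ → ℝ)
    (hF : ∀ x ∈ Set.Icc (0:ℝ) 1, HasSum (fun k => c k * x ^ (e k)) (F x)) :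
    ContinuousOn F (Set.Icc 0 1) := by
  have hs : Summable (fun k => |c k|) := by
    have := (hF 1 (by simp)).summable.abs
    simpa using this
  have h : ContinuousOn (fun x => ∑' k, c k * x ^ (e k)) (Set.Icc (0:ℝ) 1) := by
    refine continuousOn_tsum (u := fun k => |c k|) (fun k => by fun_prop) hs ?_
    intro k x hx
    rw [Real.norm_eq_abs, abs_mul, abs_pow, abs_of_nonneg hx.1]
    exact mul_le_of_le_one_right (abs_nonneg _) (pow_le_one₀ hx.1 hx.2)
  exact h.congr (fun x hx => (hF x hx).tsum_eq.symm)

theorem aux_slope (c : ℕ → ℝ) (e : ℕ → ℕ) (F : ℝ → ℝ) (d : ℝ)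
    (hF : ∀ x ∈ Set.Icc (0:ℝ) 1, HasSum (fun k => c k * x ^ (e k)) (F x))
    (hd : HasSum (fun k => c k * (e k : ℝ)) d) :
    Filter.Tendsto (fun s => (F 1 - F s) / (1 - s)) (𝓝[<] 1) (𝓝 d) := by
  have hs : Summable (fun k => |c k * (e k : ℝ)|) := hd.summable.abs
  have key : Filter.Tendsto (fun s : ℝ => ∑' k, c k * ∑ i ∈ Finset.range (e k), s ^ i)
      (𝓝[<] 1) (𝓝 (∑' k, c k * (e k : ℝ))) := by
    refine tendsto_tsum_of_dominated_convergence hs ?_ ?_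
    · intro k
      have hc : Continuous (fun s : ℝ => c k * ∑ i ∈ Finset.range (e k), s ^ i) := by fun_prop
      have := (hc.tendsto 1).mono_left (nhdsWithin_le_nhds (s := Set.Iio 1))
      simpa using this
    · filter_upwards [Ioo_mem_nhdsLT (show (0:ℝ) < 1 by norm_num)] with s hs k
      rw [Real.norm_eq_abs, abs_mul, abs_mul]
      refine mul_le_mul_of_nonneg_left ?_ (abs_nonneg _)
      have h0 : 0 ≤ ∑ i ∈ Finset.range (e k), s ^ i :=
        Finset.sum_nonneg (fun i _ => pow_nonneg hs.1.le i)
      rw [abs_of_nonneg h0, abs_of_nonneg (Nat.cast_nonneg _)]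
      calc ∑ i ∈ Finset.range (e k), s ^ i ≤ ∑ i ∈ Finset.range (e k), (1:ℝ) :=
            Finset.sum_le_sum (fun i _ => pow_le_one₀ hs.1.le hs.2.le)
        _ = e k := by simp
  rw [hd.tsum_eq] at key
  refine key.congr' ?_
  filter_upwards [Ioo_mem_nhdsLT (show (0:ℝ) < 1 by norm_num)] with s hs
  have h1 := ((hF 1 (by simp)).sub (hF s ⟨hs.1.le, hs.2.le⟩)).div_const (1 - s)
  rw [← h1.tsum_eq]
  refine tsum_congr (fun k => ?_)
  have hne : 1 - s ≠ 0 := by linarith [hs.2]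
  have := mul_neg_geom_sum s (e k)
  rw [eq_div_iff hne, one_pow, mul_assoc, mul_comm _ (1 - s), this]
  ring

theorem stmt_15
    (a : ℕ → ℝ) (f : ℝ → ℝ) (P : ℝ → ℕ → ℝ) (Φ : ℝ → ℝ → ℝ)
    (ha : ∀ k : ℕ, k ≠ 1 → 0 ≤ a k)
    (ha0 : 0 < a 0)
    (ha1 : HasSum (fun k : ℕ => if k = 1 then (0:ℝ) else a k) (-(a 1)))
    (ha01 : a 0 < -(a 1))
    (hf : ∀ x ∈ Set.Icc (0:ℝ) 1, HasSum (fun k : ℕ => a k * x ^ k) (f x))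
    (hPnn : ∀ t : ℝ, 0 ≤ t → ∀ j : ℕ, 0 ≤ P t j)
    (hPsum : ∀ t : ℝ, 0 ≤ t → HasSum (fun j : ℕ => P t j) 1)
    (hΦ : ∀ t : ℝ, 0 ≤ t → ∀ x ∈ Set.Icc (0:ℝ) 1, HasSum (fun j : ℕ => P t j * x ^ j) (Φ t x))
    (hΦ0 : ∀ x ∈ Set.Icc (0:ℝ) 1, Φ 0 x = x)
    (hKol : ∀ x ∈ Set.Icc (0:ℝ) 1, ∀ t : ℝ, 0 ≤ t → HasDerivAt (fun s => Φ s x) (f (Φ t x)) t)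
    (m : ℝ)
    (hm : HasSum (fun k : ℕ => (k : ℝ) * a k) m)
    (hnoncrit : m ≠ 0)
    (q fq β : ℝ)
    (hq : q = sInf {x : ℝ | x ∈ Set.Icc (0:ℝ) 1 ∧ f x = 0})
    (hfq : HasSum (fun k : ℕ => (k : ℝ) * a k * q ^ (k - 1)) fq)
    (hβ : β = Real.exp fq)
    (hβlt : β < 1)
    (b : ℝ)
    (hb : HasSum (fun k : ℕ => (k : ℝ) * ((k : ℝ) - 1) * a k * q ^ (k - 1)) b)
    (df : ℝ → ℝ)
    (hdf : ∀ x ∈ Set.Icc (0:ℝ) 1, HasSum (fun k : ℕ => (k : ℝ) * a k * x ^ (k - 1)) (df x))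
    :
    (fun x : ℝ =>
        Real.exp (∫ s in x..(1:ℝ), (df (q * s) - fq) * q / f (q * s))
          - (1 - b / |Real.log β| * (1 - x)))
      =o[nhdsWithin 1 (Set.Iio 1)] fun x : ℝ => 1 - x := by
  have hfc : ContinuousOn f (Set.Icc 0 1) := aux_cont_s15 a id f hf
  have hdfc : ContinuousOn df (Set.Icc 0 1) :=
    aux_cont_s15 (fun k => (k:ℝ) * a k) (fun k => k - 1) df hdf
  have hf1 : f 1 = 0 := by
    have h1 := hf 1 (by simp)
    have h2 := ha1.add (hasSum_ite_eq 1 (a 1))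
    have h3 : HasSum (fun k : ℕ => a k * 1 ^ k) (-(a 1) + a 1) := by
      refine h2.congr_fun ?_ |> fun h => h
      intro k
      by_cases hk : k = 1 <;> simp [hk]
    rw [h1.unique h3]; ring
  have hf0 : f 0 = a 0 := by
    have h1 := hf 0 (by simp)
    have h2 : HasSum (fun k : ℕ => a k * (0:ℝ) ^ k) (a 0 * 0 ^ 0) :=
      hasSum_single 0 (fun k hk => by simp [hk])
    rw [h1.unique h2]; simp
  have hSeq : {x : ℝ | x ∈ Set.Icc (0:ℝ) 1 ∧ f x = 0} = Set.Icc (0:ℝ) 1 ∩ f ⁻¹' {0} := by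
    ext x; simp
  have hScl : IsClosed {x : ℝ | x ∈ Set.Icc (0:ℝ) 1 ∧ f x = 0} := by
    rw [hSeq]
    exact hfc.preimage_isClosed_of_isClosed isClosed_Icc isClosed_singleton
  have hbdd : BddBelow {x : ℝ | x ∈ Set.Icc (0:ℝ) 1 ∧ f x = 0} := ⟨0, fun x hx => hx.1.1⟩
  have hqS : q ∈ {x : ℝ | x ∈ Set.Icc (0:ℝ) 1 ∧ f x = 0} := by
    rw [hq]
    exact hScl.csInf_mem ⟨1, by simp, hf1⟩ hbdd
  obtain ⟨⟨hq0, hq1⟩, hfq0⟩ := hqS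
  have hqpos : 0 < q := by
    rcases hq0.lt_or_eq with h | h
    · exact h
    · rw [← h, hf0] at hfq0; exact absurd hfq0 ha0.ne'
  have hfqneg : fq < 0 := by
    rw [hβ] at hβlt; exact Real.exp_lt_one_iff.1 hβlt
  have hmap : ∀ s ∈ Set.Icc (0:ℝ) 1, q * s ∈ Set.Icc (0:ℝ) 1 := fun s hs =>
    ⟨mul_nonneg hq0 hs.1, mul_le_one₀ hq1 hs.1 hs.2⟩
  have hne : ∀ s ∈ Set.Ico (0:ℝ) 1, f (q * s) ≠ 0 := by
    intro s hs h0
    have h1 : q ≤ q * s := by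
      conv_lhs => rw [hq]
      exact csInf_le hbdd ⟨hmap s ⟨hs.1, hs.2.le⟩, h0⟩
    nlinarith [hs.2]
  have hdfq : df q = fq := (hdf q ⟨hq0, hq1⟩).unique hfq
  have hA : Filter.Tendsto (fun s => (f (q * 1) - f (q * s)) / (1 - s)) (𝓝[<] 1)
      (𝓝 (q * fq)) := by
    refine aux_slope (fun k => a k * q ^ k) id (fun s => f (q * s)) _ ?_ ?_
    · intro s hs
      have := hf _ (hmap s hs)
      simpa [mul_pow, mul_assoc] using this
    · have := hfq.mul_left q
      refine (this.congr_fun fun k => ?_)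
      rcases k with _ | k
      · simp
      · simp [pow_succ]; ring
  have hB : Filter.Tendsto (fun s => (df (q * 1) - df (q * s)) / (1 - s)) (𝓝[<] 1)
      (𝓝 b) := by
    refine aux_slope (fun k => k * a k * q ^ (k - 1)) (fun k => k - 1)
      (fun s => df (q * s)) _ ?_ ?_
    · intro s hs
      have := hdf _ (hmap s hs)
      simpa [mul_pow, mul_assoc] using this
    · refine (hb.congr_fun fun k => ?_)
      rcases k with _ | k
      · simp
      · simp; ring
  set g : ℝ → ℝ := fun s => (df (q * s) - fq) * q / f (q * s) with hg
  have hlim : Filter.Tendsto g (𝓝[<] 1) (𝓝 (b / fq)) := by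
    have h := (hB.mul_const q).div hA (mul_ne_zero hqpos.ne' hfqneg.ne)
    have e1 : b * q / (q * fq) = b / fq := by
      field_simp
    rw [e1] at h
    refine h.congr' ?_
    filter_upwards [Ioo_mem_nhdsLT (show (0:ℝ) < 1 by norm_num)] with s hs
    have hn := hne s ⟨hs.1.le, hs.2⟩
    have hs1 : 1 - s ≠ 0 := by linarith [hs.2]
    simp only [hg, Pi.div_apply, mul_one, hfq0, hdfq, zero_sub]
    field_simp
    ring
  have hgc : ContinuousOn g (Set.Ico 0 1) := by
    have hm1 : ContinuousOn (fun s : ℝ => q * s) (Set.Ico 0 1) := by fun_prop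
    have hmt : Set.MapsTo (fun s : ℝ => q * s) (Set.Ico 0 1) (Set.Icc 0 1) :=
      fun s hs => hmap s ⟨hs.1, hs.2.le⟩
    exact (((hdfc.comp hm1 hmt).sub continuousOn_const).mul continuousOn_const).div
      (hfc.comp hm1 hmt) hne
  -- continuous modification
  set G : ℝ → ℝ := Function.update g 1 (b / fq) with hG
  have hGc : ContinuousOn G (Set.Icc 0 1) := by
    rw [hG, continuousOn_update_iff]
    have hset : Set.Icc (0:ℝ) 1 \ {1} = Set.Ico 0 1 := by
      ext x; simp only [Set.mem_diff, Set.mem_Icc, Set.mem_singleton_iff, Set.mem_Ico]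
      exact ⟨fun h => ⟨h.1.1, lt_of_le_of_ne h.1.2 h.2⟩, fun h => ⟨⟨h.1, h.2.le⟩, h.2.ne⟩⟩
    rw [hset]
    refine ⟨hgc, fun _ => ?_⟩
    exact hlim.mono_left (nhdsWithin_mono _ (fun x hx => hx.2))
  have hint : ∀ x : ℝ, ∫ s in x..(1:ℝ), g s = ∫ s in x..(1:ℝ), G s := by
    intro x
    refine intervalIntegral.integral_congr_ae ?_
    have : ∀ᵐ s : ℝ, s ≠ 1 := by
      simp [MeasureTheory.ae_iff]
    filter_upwards [this] with s hs _
    rw [hG, Function.update_of_ne hs]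
  have hG1 : G 1 = b / fq := by simp [hG]
  have hder : HasDerivWithinAt (fun x => ∫ s in x..(1:ℝ), G s) (-(b / fq)) (Set.Iic 1) 1 := by
    have hmem : Set.Icc (0:ℝ) 1 ∈ 𝓝[≤] (1:ℝ) := Icc_mem_nhdsLE (by norm_num)
    have := intervalIntegral.integral_hasDerivWithinAt_left (f := G) (a := 1) (b := 1)
      (s := Set.Iic 1) (t := Set.Iic 1) (by simp)
      ⟨_, hmem, hGc.aestronglyMeasurable measurableSet_Icc⟩
      ((hGc 1 (by simp)).mono_of_mem_nhdsWithin hmem)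
    rwa [hG1] at this
  have hder2 := hder.exp
  have hlog : |Real.log β| = -fq := by
    rw [hβ, Real.log_exp, abs_of_neg hfqneg]
  rw [hasDerivWithinAt_iff_isLittleO] at hder2
  have hfin := (hder2.mono (nhdsWithin_mono 1 Set.Iio_subset_Iic_self)).neg_right
  refine hfin.congr (fun x => ?_) (fun x => ?_)
  · have : (∫ s in x..(1:ℝ), (df (q * s) - fq) * q / f (q * s)) = ∫ s in x..(1:ℝ), G s := hint x
    rw [this, hlog]
    simp only [intervalIntegral.integral_same, Real.exp_zero, smul_eq_mul]
    rw [div_neg]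
    ring
  · ring
end

section
/- Assume q·f''(q) < ∞ (in the critical case q = 1 this means f''(1⁻) < ∞). Then for every fixed t ≥ 0, lim_{u→∞} (q − Φ(t+u;0))/(q − Φ(u;0)) = β^t = exp(t·f'(q)). -/
open scoped Topology

theorem stmt_17
    (a : ℕ → ℝ) (f : ℝ → ℝ) (P : ℝ → ℕ → ℝ) (Φ : ℝ → ℝ → ℝ)
    (ha : ∀ k : ℕ, k ≠ 1 → 0 ≤ a k)
    (ha0 : 0 < a 0)
    (ha1 : HasSum (fun k : ℕ => if k = 1 then (0:ℝ) else a k) (-(a 1)))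
    (ha01 : a 0 < -(a 1))
    (hf : ∀ x ∈ Set.Icc (0:ℝ) 1, HasSum (fun k : ℕ => a k * x ^ k) (f x))
    (hPnn : ∀ t : ℝ, 0 ≤ t → ∀ j : ℕ, 0 ≤ P t j)
    (hPsum : ∀ t : ℝ, 0 ≤ t → HasSum (fun j : ℕ => P t j) 1)
    (hΦ : ∀ t : ℝ, 0 ≤ t → ∀ x ∈ Set.Icc (0:ℝ) 1, HasSum (fun j : ℕ => P t j * x ^ j) (Φ t x))
    (hΦ0 : ∀ x ∈ Set.Icc (0:ℝ) 1, Φ 0 x = x)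
    (hKol : ∀ x ∈ Set.Icc (0:ℝ) 1, ∀ t : ℝ, 0 ≤ t → HasDerivAt (fun s => Φ s x) (f (Φ t x)) t)
    (q fq β : ℝ)
    (hq : q = sInf {x : ℝ | x ∈ Set.Icc (0:ℝ) 1 ∧ f x = 0})
    (hfq : HasSum (fun k : ℕ => (k : ℝ) * a k * q ^ (k - 1)) fq)
    (hβ : β = Real.exp fq)
    (b : ℝ)
    (hb : HasSum (fun k : ℕ => (k : ℝ) * ((k : ℝ) - 1) * a k * q ^ (k - 1)) b)
    :
    ∀ t : ℝ, 0 ≤ t →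
      Filter.Tendsto (fun u : ℝ => (q - Φ (t + u) 0) / (q - Φ u 0)) Filter.atTop (𝓝 (β ^ t)) ∧
      β ^ t = Real.exp (t * fq) := by
  have hs1 : Summable a := by
    have := (hf 1 ⟨by norm_num, le_refl _⟩).summable
    simpa using this
  have hf1 : f 1 = 0 := by
    have h1 := hf 1 ⟨by norm_num, le_refl _⟩
    have h2 := ha1.add (hasSum_ite_eq (1:ℕ) (a 1))
    have h3 : HasSum a (-(a 1) + a 1) := by
      refine h2.congr_fun ?_
      intro k
      by_cases hk : k = 1 <;> simp [hk]
    have h4 : HasSum a (f 1) := by simpa using h1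
    have := h4.unique h3
    linarith
  have hf0 : f 0 = a 0 := by
    have h1 := hf 0 ⟨le_refl _, by norm_num⟩
    refine h1.unique ?_
    have := hasSum_single (f := fun k : ℕ => a k * (0:ℝ) ^ k) 0 (by
      intro k hk; simp [hk])
    simpa using this
  have hfc : ContinuousOn f (Set.Icc 0 1) := by
    have h : ContinuousOn (fun x : ℝ => ∑' k, a k * x ^ k) (Set.Icc 0 1) := by
      refine continuousOn_tsum (u := fun k => |a k|) (fun k => by fun_prop) hs1.abs ?_
      intro k x hx
      rw [Real.norm_eq_abs, abs_mul, abs_of_nonneg (pow_nonneg hx.1 k)]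
      exact mul_le_of_le_one_right (abs_nonneg _) (pow_le_one₀ hx.1 hx.2)
    exact h.congr (fun x hx => (hf x hx).tsum_eq.symm)
  have hqS : q ∈ {x : ℝ | x ∈ Set.Icc (0:ℝ) 1 ∧ f x = 0} := by
    have hc : IsClosed {x : ℝ | x ∈ Set.Icc (0:ℝ) 1 ∧ f x = 0} :=
      hfc.preimage_isClosed_of_isClosed isClosed_Icc (isClosed_singleton (x := (0:ℝ)))
    rw [hq]
    exact hc.csInf_mem ⟨1, ⟨by norm_num, le_refl _⟩, hf1⟩ ⟨0, fun x hx => hx.1.1⟩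
  obtain ⟨⟨hq0', hq1⟩, hfq0⟩ := hqS
  have hq0 : 0 < q := by
    rcases hq0'.lt_or_eq with h | h
    · exact h
    · rw [← h, hf0] at hfq0; linarith
  have hmin : ∀ x ∈ Set.Icc (0:ℝ) 1, f x = 0 → q ≤ x := by
    intro x hx h
    rw [hq]
    exact csInf_le ⟨0, fun x hx => hx.1.1⟩ ⟨hx, h⟩
  have hfpos : ∀ x, 0 ≤ x → x < q → 0 < f x := by
    intro x hx hxq
    by_contra hneg
    push Not at hneg
    have hsub : Set.Icc 0 x ⊆ Set.Icc (0:ℝ) 1 := Set.Icc_subset_Icc_right (by linarith)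
    obtain ⟨y, hy, hy0⟩ := intermediate_value_Icc' hx (hfc.mono hsub)
      (show (0:ℝ) ∈ Set.Icc (f x) (f 0) from ⟨hneg, by rw [hf0]; exact ha0.le⟩)
    have := hmin y (hsub hy) hy0
    linarith [hy.2]
  -- the difference quotient
  obtain ⟨G, hGdef⟩ : ∃ G : ℝ → ℝ, G = fun x =>
    ∑' k : ℕ, a k * ∑ i ∈ Finset.range k, x ^ i * q ^ (k - 1 - i) := ⟨_, rfl⟩
  have hbd : ∀ k : ℕ, ∀ x ∈ Set.Icc (0:ℝ) q,
      ‖a k * ∑ i ∈ Finset.range k, x ^ i * q ^ (k - 1 - i)‖ ≤ |(k : ℝ) * a k * q ^ (k - 1)| := by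
    intro k x hx
    have h0 : 0 ≤ ∑ i ∈ Finset.range k, x ^ i * q ^ (k - 1 - i) :=
      Finset.sum_nonneg fun i _ => mul_nonneg (pow_nonneg hx.1 _) (pow_nonneg hq0' _)
    have h1 : ∑ i ∈ Finset.range k, x ^ i * q ^ (k - 1 - i) ≤ (k:ℝ) * q ^ (k - 1) := by
      calc _ ≤ ∑ i ∈ Finset.range k, q ^ (k - 1) := by
            refine Finset.sum_le_sum fun i hi => ?_
            have hi' := Finset.mem_range.1 hi
            calc x ^ i * q ^ (k - 1 - i) ≤ q ^ i * q ^ (k - 1 - i) :=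
                  mul_le_mul_of_nonneg_right (pow_le_pow_left₀ hx.1 hx.2 i) (pow_nonneg hq0' _)
              _ = q ^ (k - 1) := by rw [← pow_add]; congr 1; omega
        _ = _ := by simp
    rw [Real.norm_eq_abs, abs_mul, abs_of_nonneg h0, abs_mul, abs_mul, Nat.abs_cast,
      abs_of_nonneg (pow_nonneg hq0' (k - 1))]
    calc |a k| * _ ≤ |a k| * ((k:ℝ) * q ^ (k - 1)) := mul_le_mul_of_nonneg_left h1 (abs_nonneg _)
      _ = _ := by ring
  have hGc : ContinuousOn G (Set.Icc 0 q) := by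
    rw [hGdef]
    exact continuousOn_tsum (fun k => by fun_prop) hfq.summable.abs hbd
  have hGq : G q = fq := by
    rw [hGdef, ← hfq.tsum_eq]
    refine tsum_congr fun k => ?_
    have : ∑ i ∈ Finset.range k, q ^ i * q ^ (k - 1 - i) = ∑ i ∈ Finset.range k, q ^ (k - 1) := by
      refine Finset.sum_congr rfl fun i hi => ?_
      have hi' := Finset.mem_range.1 hi
      rw [← pow_add]; congr 1; omega
    simp only [this, Finset.sum_const, Finset.card_range, nsmul_eq_mul]
    ring
  have hfG : ∀ x ∈ Set.Icc (0:ℝ) q, f x = (x - q) * G x := by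
    intro x hx
    have hsm : Summable fun k : ℕ => a k * ∑ i ∈ Finset.range k, x ^ i * q ^ (k - 1 - i) :=
      Summable.of_norm_bounded hfq.summable.abs (fun k => hbd k x hx)
    have h1 := (hf x ⟨hx.1, hx.2.trans hq1⟩).sub (hf q ⟨hq0', hq1⟩)
    have h2 := hsm.hasSum.mul_left (x - q)
    rw [hfq0, sub_zero] at h1
    rw [hGdef]
    refine h1.unique (h2.congr_fun ?_)
    intro k
    have := (Commute.all x q).geom_sum₂_mul k
    calc a k * x ^ k - a k * q ^ k = a k * (x ^ k - q ^ k) := by ring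
      _ = _ := by rw [← this]; ring
  obtain ⟨M, hM⟩ := isCompact_Icc.exists_bound_of_continuousOn hGc
  obtain ⟨φ, hφ⟩ : ∃ φ : ℝ → ℝ, φ = fun u => Φ u 0 := ⟨_, rfl⟩
  have hz : (0:ℝ) ∈ Set.Icc (0:ℝ) 1 := ⟨le_refl _, by norm_num⟩
  have hφd : ∀ u, 0 ≤ u → HasDerivAt φ (f (φ u)) u := by
    intro u hu; rw [hφ]; exact hKol 0 hz u hu
  have hφ0 : φ 0 = 0 := by rw [hφ]; exact hΦ0 0 hz
  have hφnn : ∀ u, 0 ≤ u → 0 ≤ φ u := by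
    intro u hu
    rw [hφ]
    exact (hΦ u hu 0 hz).nonneg fun j => mul_nonneg (hPnn u hu j) (pow_nonneg le_rfl _)
  have hφc : ∀ s : Set ℝ, s ⊆ Set.Ici 0 → ContinuousOn φ s := fun s hs u hu =>
    (hφd u (hs hu)).continuousAt.continuousWithinAt
  have hφq : ∀ u, 0 ≤ u → φ u < q := by
    intro u hu
    have hB : ∀ x : ℝ, HasDerivAt (fun x => q - q * Real.exp (-(M+1) * x))
        (q * (M+1) * Real.exp (-(M+1) * x)) x := by
      intro x
      have h := ((((hasDerivAt_id x).const_mul (-(M+1))).exp).const_mul q).const_sub q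
      refine h.congr_deriv ?_
      simp only [id]
      ring
    have key := image_le_of_deriv_right_lt_deriv_boundary (f := φ) (f' := fun u => f (φ u))
      (a := 0) (b := u) (hφc _ fun x hx => hx.1)
      (fun x hx => (hφd x hx.1).hasDerivWithinAt) (B := fun x => q - q * Real.exp (-(M+1) * x))
      (by simp [hφ0]) hB (by
        intro x hx hxe
        have hp : 0 < q * Real.exp (-(M+1) * x) := mul_pos hq0 (Real.exp_pos _)
        have hmem : φ x ∈ Set.Icc 0 q := ⟨hφnn x hx.1, by simp only [hxe]; linarith⟩
        have hMx := hM _ hmem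
        rw [Real.norm_eq_abs] at hMx
        have := (abs_le.1 hMx).1
        simp only [hfG _ hmem]
        have he : φ x - q = - (q * Real.exp (-(M+1) * x)) := by rw [hxe]; ring
        rw [he]
        nlinarith) (x := u) ⟨hu, le_rfl⟩
    have hp : 0 < q * Real.exp (-(M+1) * u) := mul_pos hq0 (Real.exp_pos _)
    linarith
  have hmono : MonotoneOn φ (Set.Ici 0) := by
    refine monotoneOn_of_deriv_nonneg (convex_Ici 0) (hφc _ le_rfl) ?_ ?_
    · intro x hx
      rw [interior_Ici] at hx
      exact (hφd x (le_of_lt hx)).differentiableAt.differentiableWithinAt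
    · intro x hx
      rw [interior_Ici] at hx
      have hx' : 0 ≤ x := le_of_lt hx
      rw [(hφd x hx').deriv]
      exact (hfpos _ (hφnn x hx') (hφq x hx')).le
  have hreach : ∀ r, 0 ≤ r → r < q → ∃ u, 0 ≤ u ∧ r < φ u := by
    intro r hr hrq
    by_contra hcon
    push Not at hcon
    obtain ⟨z, hz1, hz2⟩ := isCompact_Icc.exists_isMinOn (Set.nonempty_Icc.2 hr)
      (hfc.mono (Set.Icc_subset_Icc_right (by linarith : r ≤ 1)))
    have hm : 0 < f z := hfpos z hz1.1 (by linarith [hz1.2])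
    have hu : 0 < (q + 1) / f z := by positivity
    obtain ⟨c, hc, hce⟩ := exists_hasDerivAt_eq_slope φ (fun u => f (φ u)) hu
      (hφc _ fun x hx => hx.1) (fun x hx => hφd x hx.1.le)
    have h1 : f z ≤ f (φ c) := hz2 ⟨hφnn c hc.1.le, hcon c hc.1.le⟩
    rw [hce, hφ0, sub_zero, sub_zero, le_div_iff₀ hu, mul_div_cancel₀ _ hm.ne'] at h1
    linarith [hφq _ hu.le]
  have hlim : Filter.Tendsto φ Filter.atTop (𝓝 q) := by
    refine tendsto_order.2 ⟨fun r hr => ?_, fun r hr => ?_⟩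
    · obtain ⟨u, hu, hru⟩ := hreach (max r 0) (le_max_right _ _) (max_lt hr hq0)
      filter_upwards [Filter.eventually_ge_atTop u] with v hv
      exact lt_of_le_of_lt (le_max_left _ _) (hru.trans_le (hmono hu (hu.trans hv) hv))
    · filter_upwards [Filter.eventually_ge_atTop 0] with v hv
      exact (hφq v hv).trans hr
  have hGlim : Filter.Tendsto (fun u => G (φ u)) Filter.atTop (𝓝 fq) := by
    rw [← hGq]
    refine (hGc q ⟨hq0', le_rfl⟩).tendsto.comp (tendsto_nhdsWithin_iff.2 ⟨hlim, ?_⟩)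
    filter_upwards [Filter.eventually_ge_atTop 0] with v hv
    exact ⟨hφnn v hv, (hφq v hv).le⟩
  have hLd : ∀ u, 0 ≤ u → HasDerivAt (fun u => Real.log (q - φ u)) (G (φ u)) u := by
    intro u hu
    have hne : q - φ u ≠ 0 := (sub_pos.2 (hφq u hu)).ne'
    refine (((hφd u hu).const_sub q).log hne).congr_deriv ?_
    rw [hfG _ ⟨hφnn u hu, (hφq u hu).le⟩]
    field_simp
    ring
  intro t ht
  have hbt : β ^ t = Real.exp (t * fq) := by
    rw [hβ, ← Real.exp_mul, mul_comm]
  refine ⟨?_, hbt⟩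
  rw [hbt]
  have hmv : ∀ u : ℝ, ∃ c, 0 ≤ u → u ≤ c ∧
      Real.log (q - φ (t + u)) - Real.log (q - φ u) = t * G (φ c) := by
    intro u
    by_cases hu : 0 ≤ u
    · rcases ht.eq_or_lt with h | h
      · exact ⟨u, fun _ => ⟨le_rfl, by simp [← h]⟩⟩
      · obtain ⟨c, hc, hce⟩ := exists_hasDerivAt_eq_slope (fun u => Real.log (q - φ u))
          (fun u => G (φ u)) (show u < t + u by linarith)
          (fun x hx => (hLd x (hu.trans hx.1)).continuousAt.continuousWithinAt)
          (fun x hx => hLd x (hu.trans hx.1.le))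
        refine ⟨c, fun _ => ⟨hc.1.le, ?_⟩⟩
        rw [hce, add_sub_cancel_right, mul_div_cancel₀ _ h.ne']
    · exact ⟨0, fun h => absurd h hu⟩
  choose c hc using hmv
  have hct : Filter.Tendsto c Filter.atTop Filter.atTop := by
    refine Filter.tendsto_atTop_mono' _ ?_ Filter.tendsto_id
    filter_upwards [Filter.eventually_ge_atTop 0] with u hu
    exact (hc u hu).1
  have hfin := (Real.continuous_exp.tendsto _).comp ((hGlim.comp hct).const_mul t)
  refine hfin.congr' ?_
  filter_upwards [Filter.eventually_ge_atTop 0] with u hu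
  have h1 := sub_pos.2 (hφq u hu)
  have h2 := sub_pos.2 (hφq (t + u) (by linarith))
  simp only [Function.comp]
  rw [← (hc u hu).2, Real.exp_sub, Real.exp_log h1, Real.exp_log h2, hφ]
end

section
/- Assume f'(q) is finite. For every j ≥ 1 the Markov Q-process transition probability admits the local representation Q_{1j}(ε) = δ_{1j} + p_j·ε + o(ε) as ε ↓ 0, where p_1 = a_1 − f'(q) (= a_1 − ln β < 0) and p_j = j·q^{j−1}·a_j ≥ 0 for j ≥ 2; that is, t ↦ Q_{1j}(t) has right derivative p_j at t = 0. -/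
open scoped Topology

open Filter in
/-- Bounded coefficients and pointwise convergence of power series give convergence of coefficients. -/
lemma coeff_tendsto_zero {l : Filter ℝ} (d : ℝ → ℕ → ℝ) (g : ℝ → ℝ → ℝ) (M : ℝ)
    (hM : ∀ᶠ t in l, ∀ j, |d t j| ≤ M)
    (hs : ∀ x ∈ Set.Ioo (0:ℝ) 1, ∀ᶠ t in l, HasSum (fun j => d t j * x ^ j) (g t x))
    (hg : ∀ x ∈ Set.Ioo (0:ℝ) 1, Tendsto (fun t => g t x) l (𝓝 0)) :
    ∀ j, Tendsto (fun t => d t j) l (𝓝 0) := by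
  intro j
  induction j using Nat.strong_induction_on with
  | _ j ih =>
    rw [Metric.tendsto_nhds]
    intro ε hε
    obtain ⟨x, hx, hxe⟩ : ∃ x ∈ Set.Ioo (0:ℝ) 1, M * x * (1 - x)⁻¹ < ε / 2 := by
      have hc : Tendsto (fun x : ℝ => M * x * (1 - x)⁻¹) (𝓝[>] 0) (𝓝 (M * 0 * (1 - 0)⁻¹)) := by
        apply Tendsto.mono_left _ nhdsWithin_le_nhds
        have : ContinuousAt (fun x : ℝ => M * x * (1 - x)⁻¹) 0 := by
          apply ContinuousAt.mul (by fun_prop)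
          apply ContinuousAt.inv₀ (by fun_prop) (by norm_num)
        exact this
      have h1 := hc.eventually (gt_mem_nhds (show M * 0 * (1 - 0)⁻¹ < ε / 2 by simpa using hε))
      have h2 : ∀ᶠ x : ℝ in 𝓝[>] 0, x ∈ Set.Ioo (0:ℝ) 1 := Ioo_mem_nhdsGT one_pos
      obtain ⟨x, h⟩ := (h2.and h1).exists
      exact ⟨x, h.1, h.2⟩
    have hx0 : 0 < x := hx.1
    have hT : Tendsto (fun t => g t x - ∑ i ∈ Finset.range j, d t i * x ^ i) l (𝓝 0) := by
      have h1 : Tendsto (fun t => ∑ i ∈ Finset.range j, d t i * x ^ i) l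
          (𝓝 (∑ i ∈ Finset.range j, 0 * x ^ i)) :=
        tendsto_finsetSum _ fun i hi => (ih i (Finset.mem_range.1 hi)).mul_const _
      have h2 := (hg x hx).sub h1
      simpa using h2
    have hT2 := (Metric.tendsto_nhds.1 hT) (x ^ j * (ε / 2)) (by positivity)
    filter_upwards [hT2, hM, hs x hx] with t h1 h2 h3
    rw [Real.dist_eq, sub_zero] at h1 ⊢
    have h4 := (hasSum_nat_add_iff' j).2 h3
    have h5 := (hasSum_nat_add_iff' 1).2 h4
    simp only [Finset.range_one, Finset.sum_singleton, zero_add] at h5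
    have hgeo : HasSum (fun n : ℕ => M * x ^ (j + 1) * x ^ n) (M * x ^ (j + 1) * (1 - x)⁻¹) :=
      (hasSum_geometric_of_lt_one hx0.le hx.2).mul_left _
    have hb : |g t x - ∑ i ∈ Finset.range j, d t i * x ^ i - d t j * x ^ j|
        ≤ M * x ^ (j + 1) * (1 - x)⁻¹ := by
      have hle : ∀ n : ℕ, |d t (n + 1 + j) * x ^ (n + 1 + j)| ≤ M * x ^ (j + 1) * x ^ n := by
        intro n
        rw [abs_mul, abs_of_pos (pow_pos hx0 _)]
        calc _ ≤ M * x ^ (n + 1 + j) := mul_le_mul_of_nonneg_right (h2 _) (by positivity)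
          _ = _ := by ring
      rw [abs_le]
      constructor
      · exact hasSum_le (fun n => (abs_le.1 (hle n)).1) hgeo.neg h5
      · exact hasSum_le (fun n => (abs_le.1 (hle n)).2) h5 hgeo
    have h6 : |d t j| * x ^ j < x ^ j * ε := by
      rw [← abs_of_pos (pow_pos hx0 j), ← abs_mul, abs_of_pos (pow_pos hx0 j)]
      have h7 : M * x ^ (j + 1) * (1 - x)⁻¹ < x ^ j * (ε / 2) := by
        calc _ = x ^ j * (M * x * (1 - x)⁻¹) := by ring
          _ < _ := mul_lt_mul_of_pos_left hxe (pow_pos hx0 j)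
      rw [abs_le] at hb
      rw [abs_lt] at h1 ⊢
      constructor <;> linarith [hb.1, hb.2, h1.1, h1.2]
    rw [mul_comm] at h6
    exact lt_of_mul_lt_mul_left h6 (pow_pos hx0 j).le

lemma prob_bound (p : ℕ → ℝ) (φ : ℝ) (hp : ∀ j, 0 ≤ p j) (h1 : HasSum p 1)
    (h2 : HasSum (fun j => p j * (1/2:ℝ) ^ j) φ) :
    ∀ j, |p j - if j = 1 then 1 else 0| ≤ 4 * (1/2 - φ) + 3 * p 0 := by
  have hd : HasSum (fun j : ℕ => if j = 1 then p 1 else 0) (p 1) := hasSum_ite_eq 1 (p 1)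
  have hd0 : HasSum (fun j : ℕ => if j = 0 then 3 * p 0 else 0) (3 * p 0) :=
    hasSum_ite_eq 0 (3 * p 0)
  have hr := h1.sub hd
  have key : 1 - p 1 ≤ 4 * (1/2 - φ) + 3 * p 0 := by
    have hl := (((h1.mul_left (1/2)).sub h2).mul_left 4).add hd0
    rw [mul_one] at hl
    refine hasSum_le (fun j => ?_) hr hl
    rcases j with _ | _ | j
    · norm_num; linarith
    · norm_num; linarith
    · have : (1/2:ℝ) ^ (j + 1 + 1) ≤ 1/4 := by
        have := pow_le_one₀ (n := j) (show (0:ℝ) ≤ 1/2 by norm_num) (by norm_num)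
        rw [pow_succ, pow_succ]; linarith
      simp only [Nat.add_eq_right, Nat.add_eq_zero_iff, if_false, one_ne_zero, and_false]
      have h3 := mul_le_mul_of_nonneg_left this (hp (j+1+1))
      linarith
  intro j
  refine le_trans ?_ key
  have hnn : ∀ j, 0 ≤ p j - (if j = 1 then p 1 else 0) := by
    intro j
    split_ifs with h
    · simp [h]
    · simpa using hp j
  have hj := le_hasSum hr j (fun i _ => hnn i)
  by_cases h : j = 1
  · subst h
    simp only [if_true] at hj ⊢
    rw [abs_le]; constructor <;> linarith
  · simp only [h, if_false, sub_zero] at hj ⊢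
    rwa [abs_of_nonneg (hp j)]

theorem stmt_19
    (a : ℕ → ℝ) (f : ℝ → ℝ) (P : ℝ → ℕ → ℝ) (Φ : ℝ → ℝ → ℝ)
    (ha : ∀ k : ℕ, k ≠ 1 → 0 ≤ a k)
    (ha0 : 0 < a 0)
    (ha1 : HasSum (fun k : ℕ => if k = 1 then (0:ℝ) else a k) (-(a 1)))
    (ha01 : a 0 < -(a 1))
    (hf : ∀ x ∈ Set.Icc (0:ℝ) 1, HasSum (fun k : ℕ => a k * x ^ k) (f x))
    (hPnn : ∀ t : ℝ, 0 ≤ t → ∀ j : ℕ, 0 ≤ P t j)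
    (hPsum : ∀ t : ℝ, 0 ≤ t → HasSum (fun j : ℕ => P t j) 1)
    (hΦ : ∀ t : ℝ, 0 ≤ t → ∀ x ∈ Set.Icc (0:ℝ) 1, HasSum (fun j : ℕ => P t j * x ^ j) (Φ t x))
    (hΦ0 : ∀ x ∈ Set.Icc (0:ℝ) 1, Φ 0 x = x)
    (hKol : ∀ x ∈ Set.Icc (0:ℝ) 1, ∀ t : ℝ, 0 ≤ t → HasDerivAt (fun s => Φ s x) (f (Φ t x)) t)
    (q fq β : ℝ)
    (hq : q = sInf {x : ℝ | x ∈ Set.Icc (0:ℝ) 1 ∧ f x = 0})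
    (hfq : HasSum (fun k : ℕ => (k : ℝ) * a k * q ^ (k - 1)) fq)
    (hβ : β = Real.exp fq)
    :
    a 1 - fq < 0 ∧
    (∀ j : ℕ, 2 ≤ j → 0 ≤ (j : ℝ) * q ^ (j - 1) * a j) ∧
    (∀ j : ℕ, 1 ≤ j →
      (j : ℝ) * q ^ (j - 1) * P 0 j / β ^ (0 : ℝ) = (if j = 1 then 1 else 0)) ∧
    ∀ j : ℕ, 1 ≤ j →
      HasDerivWithinAt (fun t : ℝ => (j : ℝ) * q ^ (j - 1) * P t j / β ^ t)
        (if j = 1 then a 1 - fq else (j : ℝ) * q ^ (j - 1) * a j) (Set.Ici 0) 0 := by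
  have hf0 : f 0 = a 0 := by
    have h1 := hf 0 (by simp)
    have h2 : HasSum (fun k : ℕ => a k * (0:ℝ) ^ k) (a 0) := by
      convert hasSum_ite_eq (0:ℕ) (a 0) using 2 with k
      rcases k with _ | k <;> simp
    exact h1.unique h2
  have hone : HasSum (fun k : ℕ => if k = 1 then a 1 else 0) (a 1) := hasSum_ite_eq 1 (a 1)
  have hf1 : f 1 = 0 := by
    have h1 := hf 1 (by simp)
    have h2 := ha1.add hone
    rw [neg_add_cancel] at h2
    refine h1.unique ?_
    convert h2 using 2 with k
    by_cases h : k = 1 <;> simp [h]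
  have hq0 : 0 < q := by
    have hlow : a 0 / (-(a 1)) ≤ q := by
      rw [hq]
      refine le_csInf ⟨1, by simp, hf1⟩ ?_
      rintro x ⟨hx, hfx⟩
      have h1 := hf x hx
      rw [hfx] at h1
      have h2 : HasSum (fun k : ℕ => (if k = 1 then a 1 * x else 0) + (if k = 0 then a 0 else 0))
          (a 1 * x + a 0) := (hasSum_ite_eq 1 (a 1 * x)).add (hasSum_ite_eq 0 (a 0))
      have h3 := hasSum_le (fun k => ?_) h2 h1
      · rw [div_le_iff₀ (by linarith)]; linarith
      · rcases k with _ | _ | k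
        · simp
        · simp
        · simpa using mul_nonneg (ha (k+1+1) (by omega)) (pow_nonneg hx.1 (k+1+1))
    exact lt_of_lt_of_le (div_pos ha0 (by linarith)) hlow
  have habs : ∀ j, |a j| ≤ -(a 1) := by
    intro j
    by_cases h : j = 1
    · subst h; rw [abs_of_neg (by linarith)]
    · rw [abs_of_nonneg (ha j h)]
      have := le_hasSum ha1 j (fun i _ => by split_ifs with h <;> [exact le_rfl; exact ha i h])
      simpa [h] using this
  have hP0 : ∀ j, P 0 j = if j = 1 then 1 else 0 := by
    intro j
    have h := coeff_tendsto_zero (l := 𝓝 (0:ℝ)) (fun _ j => P 0 j - if j = 1 then 1 else 0)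
      (fun _ _ => 0) (4 * (1/2 - Φ 0 (1/2)) + 3 * P 0 0)
      (Filter.Eventually.of_forall fun _ =>
        prob_bound (P 0) _ (hPnn 0 le_rfl) (hPsum 0 le_rfl) (hΦ 0 le_rfl (1/2) (by norm_num)))
      (fun x hx => Filter.Eventually.of_forall fun _ => by
        have h1 := hΦ 0 le_rfl x ⟨hx.1.le, hx.2.le⟩
        rw [hΦ0 x ⟨hx.1.le, hx.2.le⟩] at h1
        have h2 := h1.sub (hasSum_ite_eq (1:ℕ) x)
        rw [sub_self] at h2
        refine (congrArg (fun F : ℕ → ℝ => HasSum F _) (funext fun k => ?_)).mp h2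
        by_cases h : k = 1 <;> simp [h, sub_mul])
      (fun x hx => tendsto_const_nhds) j
    exact sub_eq_zero.1 (tendsto_nhds_unique tendsto_const_nhds h)
  have hΦP : ∀ t, 0 ≤ t → Φ t 0 = P t 0 := by
    intro t ht
    have h1 := hΦ t ht 0 (by simp)
    have h2 : HasSum (fun k : ℕ => P t k * (0:ℝ) ^ k) (P t 0) := by
      convert hasSum_ite_eq (0:ℕ) (P t 0) using 2 with k
      rcases k with _ | k <;> simp
    exact h1.unique h2
  have hslope : ∀ x ∈ Set.Icc (0:ℝ) 1,
      Filter.Tendsto (fun t => t⁻¹ * (Φ t x - x)) (𝓝[>] 0) (𝓝 (f x)) := by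
    intro x hx
    have h := (hKol x hx 0 le_rfl).hasDerivWithinAt (s := Set.Ioi 0)
    rw [hasDerivWithinAt_iff_tendsto_slope' (by simp)] at h
    rw [hΦ0 x hx] at h
    refine h.congr fun t => ?_
    rw [slope_def_field, hΦ0 x hx, sub_zero, div_eq_inv_mul]
  have hpos : ∀ᶠ t : ℝ in 𝓝[>] 0, 0 < t := self_mem_nhdsWithin
  have hcoef : ∀ j, Filter.Tendsto (fun t => t⁻¹ * (P t j - if j = 1 then 1 else 0) - a j)
      (𝓝[>] 0) (𝓝 0) := by
    refine coeff_tendsto_zero (l := 𝓝[>] (0:ℝ))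
      (fun t j => t⁻¹ * (P t j - if j = 1 then 1 else 0) - a j)
      (fun t x => t⁻¹ * (Φ t x - x) - f x)
      ((4 * (-(f (1/2))) + 3 * f 0 + 1) + -(a 1)) ?_ ?_ ?_
    · have h1 : Filter.Tendsto (fun t => 4 * (-(t⁻¹ * (Φ t (1/2) - 1/2))) + 3 * (t⁻¹ * (Φ t 0 - 0)))
          (𝓝[>] 0) (𝓝 (4 * (-(f (1/2))) + 3 * f 0)) :=
        (((hslope (1/2) (by norm_num)).neg).const_mul 4).add
          ((hslope 0 (by simp)).const_mul 3)
      filter_upwards [hpos, h1.eventually (gt_mem_nhds (lt_add_one _))] with t ht h2 j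
      refine (abs_sub _ _).trans (add_le_add (le_trans ?_ h2.le) (habs j))
      rw [abs_mul, abs_of_pos (inv_pos.2 ht), hΦP t ht.le]
      have h3 := prob_bound (P t) _ (hPnn t ht.le) (hPsum t ht.le) (hΦ t ht.le (1/2) (by norm_num)) j
      have h4 := mul_le_mul_of_nonneg_left h3 (inv_pos.2 ht).le
      linarith
    · intro x hx
      filter_upwards [hpos] with t ht
      have hx' : x ∈ Set.Icc (0:ℝ) 1 := ⟨hx.1.le, hx.2.le⟩
      have h1 := (((hΦ t ht.le x hx').sub (hasSum_ite_eq (1:ℕ) x)).mul_left t⁻¹).sub (hf x hx')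
      refine (congrArg (fun F : ℕ → ℝ => HasSum F _) (funext fun k => ?_)).mp h1
      by_cases h : k = 1
      · simp [h]; ring
      · simp [h]; ring
    · intro x hx
      have := (hslope x ⟨hx.1.le, hx.2.le⟩).sub_const (f x)
      rwa [sub_self] at this
  have hder : ∀ j, HasDerivWithinAt (fun t => P t j) (a j) (Set.Ici 0) 0 := by
    intro j
    rw [← hasDerivWithinAt_Ioi_iff_Ici, hasDerivWithinAt_iff_tendsto_slope' (by simp)]
    have h := (hcoef j).add_const (a j)
    rw [zero_add] at h
    refine h.congr fun t => ?_
    rw [slope_def_field, hP0 j, sub_zero, div_eq_inv_mul]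
    ring
  have hβ0 : 0 < β := hβ ▸ Real.exp_pos _
  refine ⟨?_, ?_, ?_, ?_⟩
  · have h1 := hfq.sub hone
    have hnn : ∀ k : ℕ, 0 ≤ (k:ℝ) * a k * q ^ (k - 1) - (if k = 1 then a 1 else 0) := by
      intro k
      by_cases h : k = 1
      · simp [h]
      · simp only [h, if_false, sub_zero]
        exact mul_nonneg (mul_nonneg k.cast_nonneg (ha k h)) (pow_nonneg hq0.le _)
    by_contra hcon
    have hz : ∀ k : ℕ, 2 ≤ k → a k = 0 := by
      intro k hk
      have h2 := le_hasSum h1 k (fun i _ => hnn i)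
      have h3 : k ≠ 1 := by omega
      simp only [h3, if_false, sub_zero] at h2
      by_contra h4
      have h5 : 0 < a k := lt_of_le_of_ne (ha k h3) (Ne.symm h4)
      have h6 : (0:ℝ) < k := by exact_mod_cast (by omega : 0 < k)
      have : 0 < (k:ℝ) * a k * q ^ (k - 1) := by positivity
      linarith
    have h7 : -(a 1) = a 0 := by
      refine ha1.unique ?_
      convert hasSum_ite_eq (0:ℕ) (a 0) using 2 with k
      rcases k with _ | _ | k
      · simp
      · simp
      · simpa using hz (k+1+1) (by omega)
    linarith
  · intro j hj
    exact mul_nonneg (mul_nonneg j.cast_nonneg (pow_nonneg hq0.le _)) (ha j (by omega))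
  · intro j hj
    rw [hP0 j]
    by_cases h : j = 1 <;> simp [h]
  · intro j hj
    have hb : HasDerivWithinAt (fun t : ℝ => β ^ t) (Real.log β * β ^ (0:ℝ)) (Set.Ici 0) 0 := by
      have := (Real.hasStrictDerivAt_const_rpow hβ0 0).hasDerivAt.hasDerivWithinAt (s := Set.Ici 0)
      rwa [mul_comm] at this
    have h := ((hder j).const_mul ((j : ℝ) * q ^ (j - 1))).fun_div hb (by simp)
    refine h.congr_deriv ?_
    rw [hP0 j, Real.rpow_zero, hβ, Real.log_exp]
    by_cases h : j = 1 <;> simp [h]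
end
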